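/- arXiv:1910.00238 — 5 statements merged into one kernel-verified Lean document; each statement's English description precedes it below -/
import Mathlib

section
/- Let R be a finite commutative ring and let f = f₁ + α·f₂, where f₁, f₂ ∈ R[x]. Then f is a permutation polynomial on the ring of dual numbers R[α] if and only if the following two conditions hold: (1) f₁ is a permutation polynomial on R; (2) for every a ∈ R, the value f₁′(a) of the formal derivative of f₁ at a is a unit of R. -/
open Polynomial

namespace DualNumber

variable {R : Type*} [CommRing R]

theorem fst_aeval (z : DualNumber R) (p : R[X]) :
    TrivSqZeroExt.fst (aeval z p) = eval (TrivSqZeroExt.fst z) p := by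
  have h := aeval_algHom_apply (TrivSqZeroExt.fstHom R R R) z p
  simpa [coe_aeval_eq_eval] using h.symm

theorem snd_aeval (z : DualNumber R) (p : R[X]) :
    TrivSqZeroExt.snd (aeval z p) =
      TrivSqZeroExt.snd z * eval (TrivSqZeroExt.fst z) (derivative p) := by
  induction p using Polynomial.induction_on' with
  | add p q hp hq => simp [hp, hq, mul_add]
  | monomial n a =>
    simp [aeval_monomial, derivative_monomial, TrivSqZeroExt.algebraMap_eq_inl]
    ring

theorem aeval_add_eps_mul_aeval (f₁ f₂ : R[X]) (z : DualNumber R) :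
    aeval z f₁ + DualNumber.eps * aeval z f₂ =
      TrivSqZeroExt.inl (eval (TrivSqZeroExt.fst z) f₁) +
        TrivSqZeroExt.inr
          (TrivSqZeroExt.snd z * eval (TrivSqZeroExt.fst z) (derivative f₁) +
            eval (TrivSqZeroExt.fst z) f₂) := by
  ext <;> simp [fst_aeval, snd_aeval]

theorem inl_add_inr_inj {a b c d : R} :
    (TrivSqZeroExt.inl a + TrivSqZeroExt.inr b : DualNumber R) =
      TrivSqZeroExt.inl c + TrivSqZeroExt.inr d ↔ a = c ∧ b = d := by
  simp [TrivSqZeroExt.ext_iff]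

end DualNumber

/-- **Theorem (permutation polynomials on R[α]).**
Let `R` be a finite commutative ring and `f = f₁ + α·f₂` with `f₁, f₂ ∈ R[x]`.
Then `f` is a permutation polynomial on the dual numbers `R[α]` iff
(1) `f₁` is a permutation polynomial on `R` and (2) `f₁'(a)` is a unit of `R`
for every `a ∈ R`. -/
theorem perm_poly_dualNumber_iff (R : Type*) [CommRing R] [Finite R]
    (f₁ f₂ : R[X]) :
    Function.Bijective
        (fun z : DualNumber R => aeval z f₁ + DualNumber.eps * aeval z f₂) ↔
      Function.Bijective (fun a : R => eval a f₁) ∧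
        ∀ a : R, IsUnit (eval a (derivative f₁)) := by
  simp only [DualNumber.aeval_add_eps_mul_aeval]
  constructor
  · rintro ⟨hinj, hsurj⟩
    refine ⟨Function.Surjective.bijective_of_finite fun c => ?_, fun a => ?_⟩
    · obtain ⟨z, hz⟩ := hsurj (TrivSqZeroExt.inl c + TrivSqZeroExt.inr 0)
      exact ⟨TrivSqZeroExt.fst z, (DualNumber.inl_add_inr_inj.1 hz).1⟩
    · have hmul : Function.Injective fun b : R => b * eval a (derivative f₁) := by
        intro b c hbc
        have h : (TrivSqZeroExt.inl a + TrivSqZeroExt.inr b : DualNumber R) =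
            TrivSqZeroExt.inl a + TrivSqZeroExt.inr c :=
          hinj (DualNumber.inl_add_inr_inj.2 (by simpa using hbc))
        exact (DualNumber.inl_add_inr_inj.1 h).2
      obtain ⟨b, hb⟩ := Finite.surjective_of_injective hmul 1
      exact IsUnit.of_mul_eq_one_right b hb
  · rintro ⟨⟨hinj, hsurj⟩, hunit⟩
    constructor
    · intro z w h
      obtain ⟨hfst, hsnd⟩ := DualNumber.inl_add_inr_inj.1 h
      have hzw : TrivSqZeroExt.fst z = TrivSqZeroExt.fst w := hinj hfst
      rw [hzw] at hsnd
      exact TrivSqZeroExt.ext hzw ((hunit _).mul_right_cancel (add_right_cancel hsnd))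
    · intro w
      obtain ⟨a, ha⟩ := hsurj (TrivSqZeroExt.fst w)
      obtain ⟨b, hb⟩ := (hunit a).exists_left_inv
      refine ⟨TrivSqZeroExt.inl a +
        TrivSqZeroExt.inr ((TrivSqZeroExt.snd w - eval a f₂) * b), ?_⟩
      ext
      · simpa using ha
      · simp [mul_assoc, hb]
end

section
/- Let p be a prime and n a positive integer with n ≤ p. Then the number of polynomials f ∈ ℤ_{p^n}[x] of degree less than (n+1)p such that both f and its formal derivative f′ are null polynomials on ℤ_{p^n} equals p^{n(n−1)p/2} if n < p, and equals p^{(n²−n+2)p/2} if n = p. -/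
open Polynomial

/-- An integer polynomial of degree less than `p` whose values are all divisible by `p` has all its
coefficients divisible by `p`. -/
lemma Polynomial.prime_dvd_coeff_of_forall_dvd_eval {p : ℕ} (hp : p.Prime) {Q : ℤ[X]}
    (hQ : Q.degree < p) (h : ∀ a : ℤ, (p : ℤ) ∣ Q.eval a) (j : ℕ) : (p : ℤ) ∣ Q.coeff j := by
  have : Fact p.Prime := ⟨hp⟩
  have h0 : Q.map (Int.castRingHom (ZMod p)) = 0 := by
    refine eq_zero_of_natDegree_lt_card_of_eval_eq_zero (ι := ZMod p) _ Function.injective_id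
      (fun i ↦ ?_) ?_
    · obtain ⟨a, rfl⟩ := ZMod.intCast_surjective i
      have := (ZMod.intCast_zmod_eq_zero_iff_dvd _ p).2 (h a)
      simpa [eval_intCast_map] using this
    · rw [ZMod.card]
      have := degree_map_le (f := Int.castRingHom (ZMod p)) (p := Q)
      by_cases h0 : Q.map (Int.castRingHom (ZMod p)) = 0
      · rw [h0, natDegree_zero]
        exact hp.pos
      · exact (natDegree_lt_iff_degree_lt h0).2 (this.trans_lt hQ)
  have := congrArg (coeff · j) h0
  simpa [ZMod.intCast_zmod_eq_zero_iff_dvd] using this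

/-- On each residue class modulo `p`, the quotient `(x ^ p - x) / p` takes every value modulo `p`. -/
lemma Int.exists_fermat_quotient_modEq {p : ℕ} (hp : p.Prime) (a s : ℤ) :
    ∃ x h : ℤ, (p : ℤ) ∣ x - a ∧ x ^ p - x = p * h ∧ (p : ℤ) ∣ h - s := by
  have hp0 : (p : ℤ) ≠ 0 := by exact_mod_cast hp.ne_zero
  obtain ⟨u, hu⟩ := Int.prime_dvd_pow_self_sub hp a
  obtain ⟨h, hh⟩ := Int.prime_dvd_pow_self_sub hp (a + p * (u - s))
  refine ⟨a + p * (u - s), h, ⟨u - s, by ring⟩, hh, ?_⟩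
  obtain ⟨v, hv⟩ := dvd_sub_pow_of_dvd_sub (R := ℤ) (p := p) (a := a + p * (u - s)) (b := a)
    ⟨u - s, by ring⟩ 1
  refine ⟨v, mul_left_cancel₀ hp0 ?_⟩
  rw [pow_one] at hv
  linear_combination hv + hu - hh

/-- The values of `∑ cᵢ (X ^ p - X) ^ i`, with `deg cᵢ < p`, are all divisible by `p ^ m`, `m ≤ p`,
if and only if `p ^ (m - i)` divides `cᵢ` for all `i`. -/
lemma Polynomial.forall_pow_dvd_eval_sum_iff {p : ℕ} (hp : p.Prime) (N : ℕ) {c : ℕ → ℤ[X]}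
    (hc : ∀ i, (c i).degree < p) {m : ℕ} (hm : m ≤ p) :
    (∀ a : ℤ, (p : ℤ) ^ m ∣ (∑ i ∈ Finset.range N, c i * (X ^ p - X) ^ i).eval a) ↔
      ∀ i < N, C ((p : ℤ) ^ (m - i)) ∣ c i := by
  have hp0 : (p : ℤ) ≠ 0 := by exact_mod_cast hp.ne_zero
  constructor
  · induction m with
    | zero => intro _ i _; simp
    | succ m ih =>
      intro H
      have IH := ih (by omega) fun a ↦ (pow_dvd_pow _ (by omega)).trans (H a)
      have hd : ∀ i, ∃ d : ℤ[X], i < N → c i = C ((p : ℤ) ^ (m - i)) * d := fun i ↦ by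
        by_cases hi : i < N
        · obtain ⟨d, hd⟩ := IH i hi
          exact ⟨d, fun _ ↦ hd⟩
        · exact ⟨0, fun h ↦ absurd h hi⟩
      choose d hd using hd
      have key : ∀ a s : ℤ, (p : ℤ) ∣ ∑ i ∈ Finset.range N,
          if i < m + 1 then (d i).eval a * s ^ i else 0 := by
        intro a s
        obtain ⟨x, h, hxa, hxh, hhs⟩ := Int.exists_fermat_quotient_modEq hp a s
        have h1 : (p : ℤ) ∣ ∑ i ∈ Finset.range N,
            if i < m + 1 then (d i).eval x * h ^ i else (0 : ℤ) := by
          have h2 := H x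
          rw [eval_finsetSum] at h2
          have h3 : (p : ℤ) ^ (m + 1) ∣ (p : ℤ) ^ m * (∑ i ∈ Finset.range N,
            if i < m + 1 then (d i).eval x * h ^ i else (0 : ℤ)) := by
            rw [← dvd_sub_right h2, Finset.mul_sum, ← Finset.sum_sub_distrib]
            refine Finset.dvd_sum fun i hi ↦ ?_
            have hev : (c i * (X ^ p - X) ^ i).eval x = (c i).eval x * (p ^ i * h ^ i) := by
              simp [hxh, mul_pow]
            rw [hev]
            split_ifs with him
            · rw [hd i (Finset.mem_range.1 hi)]
              have : (p : ℤ) ^ m = p ^ (m - i) * p ^ i := by rw [← pow_add]; congr 1; omega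
              rw [this, eval_mul, eval_C]
              exact ⟨0, by ring⟩
            · rw [mul_zero, sub_zero]
              exact ((pow_dvd_pow _ (by omega)).mul_right _).mul_left _
          rw [pow_succ] at h3
          exact (mul_dvd_mul_iff_left (pow_ne_zero _ hp0)).1 h3
        rw [← dvd_sub_right h1, ← Finset.sum_sub_distrib]
        refine Finset.dvd_sum fun i _ ↦ ?_
        split_ifs
        · have e1 : (p : ℤ) ∣ (d i).eval x - (d i).eval a := hxa.trans (sub_dvd_eval_sub _ _ _)
          have e2 : (p : ℤ) ∣ h ^ i - s ^ i := hhs.trans (sub_dvd_pow_sub_pow _ _ _)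
          have : (d i).eval x * h ^ i - (d i).eval a * s ^ i =
            ((d i).eval x - (d i).eval a) * h ^ i + (d i).eval a * (h ^ i - s ^ i) := by ring
          rw [this]
          exact dvd_add (e1.mul_right _) (e2.mul_left _)
        · simp
      intro i hi
      by_cases him : i < m + 1
      · have hda : ∀ a : ℤ, (p : ℤ) ∣ (d i).eval a := by
          intro a
          have := prime_dvd_coeff_of_forall_dvd_eval hp
            (Q := ∑ i ∈ Finset.range N, if i < m + 1 then C ((d i).eval a) * X ^ i else 0) ?_ ?_ i
          · rw [finsetSum_coeff, Finset.sum_eq_single i] at this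
            · simpa [him] using this
            · intro b _ hb
              split_ifs
              · simp [coeff_X_pow, hb.symm]
              · simp
            · intro h; simp at h; omega
          · refine (degree_sum_le _ _).trans_lt ((Finset.sup_lt_iff (WithBot.bot_lt_coe p)).2 ?_)
            intro b _
            split_ifs with hb
            · refine (degree_C_mul_X_pow_le _ _).trans_lt ?_
              exact Nat.cast_lt.2 (by omega)
            · simp
          · intro s
            have := key a s
            rw [eval_finsetSum]
            convert this using 2 with b
            split_ifs <;> simp
        have hdeg : (d i).degree < p := by
          have := hc i
          rwa [hd i hi, degree_C_mul (pow_ne_zero _ hp0)] at this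
        have hdiv : C (p : ℤ) ∣ d i := (C_dvd_iff_dvd_coeff _ _).2
          (prime_dvd_coeff_of_forall_dvd_eval hp hdeg hda)
        rw [hd i hi, show m + 1 - i = (m - i) + 1 by omega, pow_succ, C_mul]
        exact mul_dvd_mul_left _ hdiv
      · rw [show m + 1 - i = 0 by omega]
        simp
  · intro H a
    rw [eval_finsetSum]
    refine Finset.dvd_sum fun i hi ↦ ?_
    obtain ⟨d, hd⟩ := H i (Finset.mem_range.1 hi)
    obtain ⟨u, hu⟩ := Int.prime_dvd_pow_self_sub hp a
    have : (c i * (X ^ p - X) ^ i).eval a = p ^ (m - i + i) * (d.eval a * u ^ i) := by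
      rw [hd]
      simp only [eval_mul, eval_C, eval_pow, eval_sub, eval_X, hu]
      ring
    rw [this]
    exact (pow_dvd_pow _ (by omega)).mul_right _

/-- The exponent `e` such that `p ^ e` divides the `k`-th digit in base `X ^ p - X` of the
polynomials which are null modulo `p ^ n` together with their derivative. -/
def nullDerivExponent (p n k : ℕ) : ℕ := if k = p then 0 else min n (n + 1 - k)

lemma Polynomial.forall_pow_dvd_eval_and_derivative_iff {p n : ℕ} (hp : p.Prime) (hnp : n ≤ p)
    {c : ℕ → ℤ[X]} (hc : ∀ i, (c i).degree < p) {F : ℤ[X]}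
    (hF : F = ∑ i ∈ Finset.range (n + 1), c i * (X ^ p - X) ^ i) :
    ((∀ a : ℤ, (p : ℤ) ^ n ∣ F.eval a) ∧ ∀ a : ℤ, (p : ℤ) ^ n ∣ (derivative F).eval a) ↔
      ∀ i < n + 1, C ((p : ℤ) ^ nullDerivExponent p n i) ∣ c i := by
  have hp' : Prime (p : ℤ) := Nat.prime_iff_prime_int.1 hp
  have hder : (∀ a : ℤ, (p : ℤ) ^ n ∣ F.eval a) → ((∀ a : ℤ, (p : ℤ) ^ n ∣ (derivative F).eval a) ↔
      ∀ a : ℤ, (p : ℤ) ^ n ∣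
        (∑ i ∈ Finset.range n, (C (i + 1 : ℤ) * c (i + 1)) * (X ^ p - X) ^ i).eval a) := by
    intro h
    rw [hF, forall_pow_dvd_eval_sum_iff hp _ hc hnp] at h
    refine forall_congr' fun a ↦ ?_
    have h1 : (p : ℤ) ^ n ∣
        (∑ i ∈ Finset.range (n + 1), derivative (c i) * (X ^ p - X) ^ i).eval a := by
      refine (forall_pow_dvd_eval_sum_iff hp _ (fun i ↦ degree_derivative_le.trans_lt (hc i)) hnp).2
        (fun i hi ↦ ?_) a
      obtain ⟨d, hd⟩ := h i hi
      exact ⟨derivative d, by rw [hd, derivative_C_mul]⟩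
    have h2 : derivative F = ∑ i ∈ Finset.range (n + 1), derivative (c i) * (X ^ p - X) ^ i +
        (C (p : ℤ) * X ^ (p - 1) - 1) *
          ∑ i ∈ Finset.range n, (C (i + 1 : ℤ) * c (i + 1)) * (X ^ p - X) ^ i := by
      rw [hF, derivative_sum]
      simp only [derivative_mul, Finset.sum_add_distrib]
      congr 1
      rw [Finset.sum_range_succ', Finset.mul_sum]
      simp only [pow_zero, derivative_one, mul_zero, add_zero]
      refine Finset.sum_congr rfl fun i _ ↦ ?_
      simp [derivative_pow]
      ring
    rw [h2, eval_add, dvd_add_right h1, eval_mul]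
    refine ⟨fun h3 ↦ ?_, fun h3 ↦ h3.mul_left _⟩
    refine IsCoprime.dvd_of_dvd_mul_left ?_ h3
    refine IsCoprime.pow_left ⟨a ^ (p - 1), -1, ?_⟩
    simp
    ring
  rw [and_congr_right hder, hF, forall_pow_dvd_eval_sum_iff hp _ hc hnp,
    forall_pow_dvd_eval_sum_iff hp n (fun i ↦ ?_) hnp]
  · constructor
    · rintro ⟨h1, h2⟩ i hi
      unfold nullDerivExponent
      split_ifs with hip
      · simp
      · rcases i with _ | i
        · simpa using h1 0 hi
        · have h3 := h2 i (by omega)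
          rw [C_dvd_iff_dvd_coeff] at h3 ⊢
          intro j
          have h4 := h3 j
          rw [coeff_C_mul] at h4
          rw [show min n (n + 1 - (i + 1)) = n - i by omega]
          refine IsCoprime.dvd_of_dvd_mul_left (IsCoprime.pow_left ?_) h4
          rw [show (i + 1 : ℤ) = ((i + 1 : ℕ) : ℤ) by push_cast; rfl, Nat.isCoprime_iff_coprime,
            hp.coprime_iff_not_dvd]
          intro hdvd
          have := Nat.le_of_dvd (by omega) hdvd
          omega
    · intro h
      refine ⟨fun i hi ↦ ?_, fun i hi ↦ ?_⟩
      · refine dvd_trans ?_ (h i hi)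
        refine _root_.map_dvd C (pow_dvd_pow _ ?_)
        unfold nullDerivExponent
        split_ifs <;> omega
      · have h1 := h (i + 1) (by omega)
        unfold nullDerivExponent at h1
        split_ifs at h1 with hip
        · refine dvd_mul_of_dvd_left (_root_.map_dvd C ?_) _
          rw [show n - i = 1 by omega, ← hip]
          simp
        · rw [show min n (n + 1 - (i + 1)) = n - i by omega] at h1
          exact h1.mul_left _
  · rw [degree_C_mul (by positivity)]
    exact hc _

lemma Polynomial.Monic.exists_sum_mul_pow {R : Type*} [CommRing R] [Nontrivial R] {g : R[X]}
    (hg : g.Monic) (N : ℕ) {f : R[X]}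
    (hf : f.degree < (N * g.natDegree : ℕ)) :
    ∃ c : ℕ → R[X], (∀ i, (c i).degree < g.degree) ∧ f = ∑ i ∈ Finset.range N, c i * g ^ i := by
  induction N generalizing f with
  | zero =>
    refine ⟨0, fun i ↦ ?_, ?_⟩
    · simpa [bot_lt_iff_ne_bot] using hg.ne_zero
    · simpa [Nat.WithBot.lt_zero_iff] using hf
  | succ N ih =>
    have hq : (f /ₘ g).degree < (N * g.natDegree : ℕ) := by
      by_cases h0 : f /ₘ g = 0
      · rw [h0, degree_zero]; exact WithBot.bot_lt_coe _
      have hfg : g.degree ≤ f.degree := by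
        by_contra h
        exact h0 ((divByMonic_eq_zero_iff hg).2 (not_le.1 h))
      have hf0 : f ≠ 0 := by rintro rfl; simp at h0
      rw [← natDegree_lt_iff_degree_lt hf0] at hf
      rw [← natDegree_lt_iff_degree_lt h0, natDegree_divByMonic _ hg]
      have := natDegree_le_natDegree hfg
      rw [Nat.succ_mul] at hf
      omega
    obtain ⟨c, hc, h⟩ := ih hq
    refine ⟨fun i ↦ Nat.casesOn i (f %ₘ g) c, fun i ↦ ?_, ?_⟩
    · cases i with
      | zero => exact degree_modByMonic_lt _ hg
      | succ i => exact hc i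
    · rw [Finset.sum_range_succ']
      simp only [pow_zero, mul_one, pow_succ, ← mul_assoc]
      rw [← Finset.sum_mul, ← h]
      conv_lhs => rw [← modByMonic_add_div f g]
      rw [mul_comm g, add_comm]
      rfl

lemma Polynomial.Monic.eq_zero_of_sum_mul_pow_eq_zero {R : Type*} [CommRing R] {g : R[X]}
    (hg : g.Monic) (N : ℕ) {c : ℕ → R[X]}
    (hc : ∀ i, (c i).degree < g.degree) (h : ∑ i ∈ Finset.range N, c i * g ^ i = 0) :
    ∀ i < N, c i = 0 := by
  induction N generalizing c with
  | zero => intro i hi; omega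
  | succ N ih =>
    rw [Finset.sum_range_succ'] at h
    simp only [pow_zero, mul_one, pow_succ, ← mul_assoc] at h
    rw [← Finset.sum_mul] at h
    obtain ⟨h1, h2⟩ := div_modByMonic_unique (f := 0) (g := g)
      (∑ i ∈ Finset.range N, c (i + 1) * g ^ i) (c 0) hg ⟨by rw [← h]; ring, hc 0⟩
    rw [zero_divByMonic] at h1
    rw [zero_modByMonic] at h2
    intro i hi
    cases i with
    | zero => exact h2.symm
    | succ i => exact ih (fun i ↦ hc (i + 1)) h1.symm i (by omega)

lemma Polynomial.card_degree_lt_dvd_coeff {R : Type*} [CommRing R] (d : ℕ) (b : R) :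
    Nat.card {q : R[X] // q.degree < d ∧ ∀ j, b ∣ q.coeff j} = Nat.card {x : R // b ∣ x} ^ d := by
  classical
  have h := Nat.card_fun (α := Fin d) (β := {x : R // b ∣ x})
  rw [Nat.card_fin] at h
  rw [← h]
  refine Nat.card_congr (Equiv.ofBijective (fun q j ↦ ⟨q.1.coeff j, q.2.2 j⟩) ⟨?_, fun v ↦ ?_⟩)
  · rintro ⟨q, hq, _⟩ ⟨r, hr, _⟩ h
    ext j
    by_cases hj : j < d
    · exact congrArg Subtype.val (congrFun h ⟨j, hj⟩)
    · have hj' : (d : WithBot ℕ) ≤ j := by exact_mod_cast not_lt.1 hj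
      simp only
      rw [coeff_eq_zero_of_degree_lt (hq.trans_le hj'), coeff_eq_zero_of_degree_lt (hr.trans_le hj')]
  · refine ⟨⟨ofFn d (fun j ↦ (v j).1), ofFn_degree_lt _, fun j ↦ ?_⟩, ?_⟩
    · by_cases hj : j < d
      · rw [ofFn_coeff_eq_val_of_lt _ hj]
        exact (v ⟨j, hj⟩).2
      · rw [ofFn_coeff_eq_zero_of_ge _ (not_lt.1 hj)]
        exact dvd_zero _
    · ext j
      simp

lemma ZMod.card_pow_dvd {p n e : ℕ} (hp : p.Prime) (he : e ≤ n) :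
    Nat.card {x : ZMod (p ^ n) // (p : ZMod (p ^ n)) ^ e ∣ x} = p ^ (n - e) := by
  have h : Nat.card (AddSubgroup.zmultiples ((p ^ e : ℕ) : ZMod (p ^ n))) = p ^ (n - e) := by
    rw [Nat.card_zmultiples, ZMod.addOrderOf_coe _ (pow_ne_zero _ hp.ne_zero),
      Nat.gcd_eq_right (pow_dvd_pow _ he), Nat.pow_div he hp.pos]
  rw [← h]
  refine Nat.card_congr (Equiv.subtypeEquivRight fun x ↦ ?_)
  rw [AddSubgroup.mem_zmultiples_iff, dvd_def]
  constructor
  · rintro ⟨y, rfl⟩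
    obtain ⟨k, rfl⟩ := ZMod.intCast_surjective y
    exact ⟨k, by simp [mul_comm]⟩
  · rintro ⟨k, rfl⟩
    exact ⟨k, by simp [mul_comm]⟩

lemma ZMod.pow_dvd_intCast_iff {p n e : ℕ} (he : e ≤ n) (x : ℤ) :
    (p : ZMod (p ^ n)) ^ e ∣ (x : ZMod (p ^ n)) ↔ (p : ℤ) ^ e ∣ x := by
  constructor
  · rintro ⟨y, hy⟩
    obtain ⟨k, rfl⟩ := ZMod.intCast_surjective y
    have : ((x - p ^ e * k : ℤ) : ZMod (p ^ n)) = 0 := by push_cast; rw [hy]; ring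
    rw [ZMod.intCast_zmod_eq_zero_iff_dvd] at this
    push_cast at this
    exact (dvd_sub_left (dvd_mul_right _ _)).1 ((pow_dvd_pow _ he).trans this)
  · rintro ⟨k, rfl⟩
    exact ⟨k, by push_cast; ring⟩

lemma nullDerivExponent_le (p n k : ℕ) : nullDerivExponent p n k ≤ n := by
  unfold nullDerivExponent
  split_ifs <;> omega

lemma Polynomial.null_and_derivative_null_iff {p n : ℕ} (hp : p.Prime) (hnp : n ≤ p)
    {c : ℕ → (ZMod (p ^ n))[X]} (hc : ∀ i, (c i).degree < p) {f : (ZMod (p ^ n))[X]}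
    (hf : f = ∑ i ∈ Finset.range (n + 1), c i * (X ^ p - X) ^ i) :
    ((∀ a, eval a f = 0) ∧ ∀ a, eval a (derivative f) = 0) ↔
      ∀ i < n + 1, ∀ j, (p : ZMod (p ^ n)) ^ nullDerivExponent p n i ∣ (c i).coeff j := by
  have hlift : ∀ i, ∃ q : ℤ[X], q.map (Int.castRingHom (ZMod (p ^ n))) = c i ∧
      q.degree = (c i).degree := fun i ↦ by
    refine exists_degree_eq_of_mem_lifts ?_
    rw [lifts_iff_coeff_lifts]
    exact fun j ↦ ZMod.intCast_surjective _
  choose q hq hqdeg using hlift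
  have hnull : ∀ F : ℤ[X], (∀ a, eval a (F.map (Int.castRingHom (ZMod (p ^ n)))) = 0) ↔
      ∀ a : ℤ, (p : ℤ) ^ n ∣ F.eval a := fun F ↦ by
    rw [ZMod.intCast_surjective.forall]
    refine forall_congr' fun a ↦ ?_
    rw [eval_intCast_map, eq_intCast, ZMod.intCast_zmod_eq_zero_iff_dvd]
    push_cast
    rfl
  have hmap : f = (∑ i ∈ Finset.range (n + 1), q i * (X ^ p - X) ^ i).map
      (Int.castRingHom (ZMod (p ^ n))) := by
    simp [hf, Polynomial.map_sum, hq]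
  rw [hmap, derivative_map, hnull, hnull,
    forall_pow_dvd_eval_and_derivative_iff hp hnp (fun i ↦ (hqdeg i).trans_lt (hc i)) rfl]
  refine forall₂_congr fun i _ ↦ ?_
  rw [C_dvd_iff_dvd_coeff]
  refine forall_congr' fun j ↦ ?_
  rw [← hq, coeff_map, eq_intCast, ZMod.pow_dvd_intCast_iff (nullDerivExponent_le _ _ _)]

lemma card_null_and_derivative_null {p n : ℕ} (hp : p.Prime) (hn : 0 < n) (hnp : n ≤ p) :
    Nat.card {f : (ZMod (p ^ n))[X] //
      f.degree < ((n + 1) * p : ℕ) ∧ (∀ a : ZMod (p ^ n), eval a f = 0) ∧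
        ∀ a : ZMod (p ^ n), eval a (derivative f) = 0} =
      p ^ ((∑ i ∈ Finset.range (n + 1), (n - nullDerivExponent p n i)) * p) := by
  have : Fact (1 < p ^ n) := ⟨Nat.one_lt_pow hn.ne' hp.one_lt⟩
  have hXp : (X : (ZMod (p ^ n))[X]).degree < p := by
    rw [degree_X]; exact_mod_cast hp.one_lt
  have hg : (X ^ p - X : (ZMod (p ^ n))[X]).Monic := monic_X_pow_sub hXp
  have hgd : (X ^ p - X : (ZMod (p ^ n))[X]).degree = p := by
    rw [degree_sub_eq_left_of_degree_lt] <;> simp only [degree_X_pow]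
    exact hXp
  have hgn : (X ^ p - X : (ZMod (p ^ n))[X]).natDegree = p := natDegree_eq_of_degree_eq_some hgd
  have hpi : Nat.card (∀ i : Fin (n + 1), {q : (ZMod (p ^ n))[X] // q.degree < p ∧
      ∀ j, (p : ZMod (p ^ n)) ^ nullDerivExponent p n i ∣ q.coeff j}) =
      p ^ ((∑ i ∈ Finset.range (n + 1), (n - nullDerivExponent p n i)) * p) := by
    rw [Nat.card_pi]
    simp_rw [card_degree_lt_dvd_coeff, ZMod.card_pow_dvd hp (nullDerivExponent_le _ _ _)]
    rw [Fin.prod_univ_eq_prod_range (fun i ↦ (p ^ (n - nullDerivExponent p n i)) ^ p),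
      Finset.prod_pow, Finset.prod_pow_eq_pow_sum, pow_mul]
  rw [← hpi]
  symm
  have hsum : ∀ c : ∀ i : Fin (n + 1), {q : (ZMod (p ^ n))[X] // q.degree < p ∧
      ∀ j, (p : ZMod (p ^ n)) ^ nullDerivExponent p n i ∣ q.coeff j},
      ∃ c' : ℕ → (ZMod (p ^ n))[X], (∀ i, (c' i).degree < p) ∧ (∀ i : Fin (n + 1), c' i = c i) ∧
      ∑ i, (c i).1 * (X ^ p - X) ^ (i : ℕ) =
        ∑ i ∈ Finset.range (n + 1), c' i * (X ^ p - X) ^ i := by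
    intro c
    refine ⟨fun i ↦ if h : i < n + 1 then (c ⟨i, h⟩).1 else 0, fun i ↦ ?_, fun i ↦ ?_, ?_⟩
    · dsimp only
      split_ifs with h
      · exact (c ⟨i, h⟩).2.1
      · rw [degree_zero]; exact WithBot.bot_lt_coe _
    · simp only [i.is_lt, dif_pos]
    · rw [Finset.sum_range]
      simp only [Fin.is_lt, dif_pos]
  refine Nat.card_congr (Equiv.ofBijective
    (fun c ↦ ⟨∑ i, (c i).1 * (X ^ p - X) ^ (i : ℕ), ?_, ?_⟩) ⟨?_, ?_⟩)
  · refine (degree_sum_le _ _).trans_lt ((Finset.sup_lt_iff (WithBot.bot_lt_coe _)).2 fun i _ ↦ ?_)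
    have h1 := (c i).2.1
    by_cases h0 : (c i).1 = 0
    · rw [h0, zero_mul, degree_zero]; exact WithBot.bot_lt_coe _
    rw [(hg.pow _).degree_mul, degree_pow' (by simp [hg.leadingCoeff]), hgd, degree_eq_natDegree h0]
    rw [← natDegree_lt_iff_degree_lt h0] at h1
    have h2 : i.1 * p ≤ n * p := Nat.mul_le_mul_right _ (by omega)
    rw [nsmul_eq_mul]
    have : (c i).1.natDegree + i.1 * p < (n + 1) * p := by rw [add_mul]; omega
    exact_mod_cast this
  · obtain ⟨c', h1, h2, h3⟩ := hsum c
    refine (null_and_derivative_null_iff hp hnp h1 h3).2 fun i hi j ↦ ?_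
    rw [h2 ⟨i, hi⟩]
    exact (c ⟨i, hi⟩).2.2 j
  · intro c d hcd
    have hcd := congrArg Subtype.val hcd
    dsimp only at hcd
    obtain ⟨c', h1, h2, h3⟩ := hsum c
    obtain ⟨d', k1, k2, k3⟩ := hsum d
    rw [h3, k3, ← sub_eq_zero, ← Finset.sum_sub_distrib] at hcd
    simp_rw [← sub_mul] at hcd
    have := hg.eq_zero_of_sum_mul_pow_eq_zero (n + 1) (c := fun i ↦ c' i - d' i) (fun i ↦ by
      rw [hgd]; exact (degree_sub_le _ _).trans_lt (max_lt (h1 i) (k1 i))) hcd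
    funext i
    apply Subtype.ext
    rw [← h2, ← k2, ← sub_eq_zero]
    exact this i i.2
  · rintro ⟨f, hf, hf2⟩
    obtain ⟨c, hc, hfc⟩ := hg.exists_sum_mul_pow (n + 1) (f := f) (by rwa [hgn])
    rw [hgd] at hc
    have := (null_and_derivative_null_iff hp hnp hc hfc).1 hf2
    refine ⟨fun i ↦ ⟨c i, hc i, this i i.2⟩, Subtype.ext ?_⟩
    dsimp only
    rw [hfc, Finset.sum_range]

/-- **Corollary (counting null polynomials with null derivative).**
Let `p` be a prime and `n ≤ p` a positive integer.  The number of polynomials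
`f` over `ℤ_{p^n}` of degree less than `(n+1)p` such that both `f` and `f'`
are null polynomials on `ℤ_{p^n}` equals `p^{n(n-1)p/2}` if `n < p` and
`p^{(n²-n+2)p/2}` if `n = p`. -/
theorem card_null_polys_with_null_deriv_deg_lt (p n : ℕ) (hp : p.Prime)
    (hn : 0 < n) (hnp : n ≤ p) :
    (n < p →
      Nat.card {f : Polynomial (ZMod (p ^ n)) //
          f.degree < ((n + 1) * p : ℕ) ∧ (∀ a : ZMod (p ^ n), eval a f = 0) ∧
            ∀ a : ZMod (p ^ n), eval a (derivative f) = 0} =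
        p ^ (n * (n - 1) * p / 2)) ∧
    (n = p →
      Nat.card {f : Polynomial (ZMod (p ^ n)) //
          f.degree < ((n + 1) * p : ℕ) ∧ (∀ a : ZMod (p ^ n), eval a f = 0) ∧
            ∀ a : ZMod (p ^ n), eval a (derivative f) = 0} =
        p ^ ((n ^ 2 - n + 2) * p / 2)) := by
  rw [card_null_and_derivative_null hp hn hnp]
  have hlow : ∀ m ≤ n, m < p → ∑ i ∈ Finset.range (m + 1), (n - nullDerivExponent p n i) =
      ∑ i ∈ Finset.range m, i := fun m hm hmp ↦ by
    rw [Finset.sum_range_succ']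
    have h0 : n - nullDerivExponent p n 0 = 0 := by
      unfold nullDerivExponent
      rw [if_neg hp.ne_zero.symm]
      omega
    rw [h0, add_zero]
    refine Finset.sum_congr rfl fun i hi ↦ ?_
    have := Finset.mem_range.1 hi
    unfold nullDerivExponent
    rw [if_neg (by omega)]
    omega
  refine ⟨fun h ↦ ?_, fun h ↦ ?_⟩
  · rw [hlow n le_rfl h, ← Finset.sum_range_id_mul_two]
    congr 1
    rw [mul_right_comm, Nat.mul_div_cancel _ two_pos]
  · obtain ⟨m, rfl⟩ : ∃ m, n = m + 1 := ⟨n - 1, by omega⟩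
    rw [Finset.sum_range_succ, hlow m (by omega) (by omega)]
    have h1 : m + 1 - nullDerivExponent p (m + 1) (m + 1) = m + 1 := by
      simp [nullDerivExponent, h]
    have h2 := Finset.sum_range_id_mul_two m
    have h3 : (m + 1) ^ 2 - (m + 1) + 2 = (∑ i ∈ Finset.range m, i + (m + 1)) * 2 := by
      rw [add_mul, h2]
      cases m with
      | zero => rfl
      | succ k =>
        have : (k + 1 + 1) ^ 2 = (k + 1) * k + (k + 1 + 1) * 2 - 2 + (k + 1 + 1) := by
          ring_nf
          omega
        rw [this, Nat.add_sub_cancel, Nat.add_sub_cancel]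
        omega
    rw [h1, h3]
    congr 1
    rw [mul_right_comm, Nat.mul_div_cancel _ two_pos]
end

section
/- Let p be a prime and n a positive integer with 1 ≤ n ≤ p. Then the order of the pointwise stabilizer St_α(ℤ_{p^n}) of ℤ_{p^n} in the group of polynomial permutations of ℤ_{p^n}[α] is: (p−1)^p if n = 1; p^{np} if 1 < n < p; and p^{(n−1)p} if n = p. -/
open Polynomial

/-- The pointwise stabilizer `St_α(R)` of `R` in the group of polynomial
permutations of the dual numbers `R[α]`. -/
def polyStabilizer (R : Type*) [CommRing R] :
    Set (DualNumber R → DualNumber R) :=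
  {G : DualNumber R → DualNumber R |
    (∃ f : Polynomial (DualNumber R), ∀ a, G a = f.eval a) ∧
      Function.Bijective G ∧
        ∀ r : R, G (algebraMap R (DualNumber R) r) = algebraMap R (DualNumber R) r}

open TrivSqZeroExt in
/-- A member of `polyStabilizer R` sends `a + b α` to `a + φ a * b α`, where `φ` is the unit-valued
derivative function of a polynomial inducing the identity on `R`. -/
theorem polyStabilizer_eq_image (R : Type*) [CommRing R] :
    polyStabilizer R =
      Set.image
        (fun (φ : R → R) (z : DualNumber R) => (inl z.fst + inr (φ z.fst * z.snd) : DualNumber R))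
        {φ : R → R | (∃ f : R[X], (∀ a, f.eval a = a) ∧ ∀ a, f.derivative.eval a = φ a) ∧
          ∀ a, IsUnit (φ a)} := by
  have key (f : (DualNumber R)[X]) (z : DualNumber R) :
      f.eval z = f.eval (inl z.fst) +
        inr ((f.map (fstHom R R R).toRingHom).derivative.eval z.fst * z.snd) := by
    have hz : z = inl z.fst + inr z.snd := (inl_fst_add_inr_snd_eq z).symm
    have hfst : (f.derivative.eval (inl z.fst)).fst =
        (f.map (fstHom R R R).toRingHom).derivative.eval z.fst := by
      have h := Polynomial.eval_map_apply (p := f.derivative) (fstHom R R R).toRingHom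
        (inl z.fst : DualNumber R)
      rw [derivative_map]
      exact h.symm
    conv_lhs => rw [hz]
    rw [Polynomial.eval_add_of_sq_eq_zero _ _ _ (by simp [pow_two]), ← hfst]
    congr 1
    ext <;> simp [DualNumber, mul_comm]
  ext G
  constructor
  · rintro ⟨⟨f, hf⟩, hbij, hfix⟩
    set g := f.map (fstHom R R R).toRingHom
    have hG (z) : G z = inl z.fst + inr (g.derivative.eval z.fst * z.snd) := by
      rw [hf, key, ← hf]
      congr 1
      exact hfix z.fst
    refine ⟨fun a => g.derivative.eval a, ⟨⟨g, fun a => ?_, fun a => rfl⟩, fun a => ?_⟩, ?_⟩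
    · have h := Polynomial.eval_map_apply (p := f) (fstHom R R R).toRingHom (inl a : DualNumber R)
      have h2 := hfix a
      rw [hf] at h2
      change f.eval (inl a) = inl a at h2
      rw [h2] at h
      exact h
    · obtain ⟨z, hz⟩ := hbij.2 (inl a + inr 1)
      rw [hG] at hz
      have h1 := congrArg fst hz
      have h2 := congrArg snd hz
      simp at h1 h2
      rw [h1] at h2
      exact IsUnit.of_mul_eq_one _ h2
    · funext z
      exact (hG z).symm
  · rintro ⟨φ, ⟨⟨f, hf, hd⟩, hu⟩, rfl⟩
    refine ⟨⟨f.map (algebraMap R (DualNumber R)), fun z => ?_⟩, ⟨?_, ?_⟩, fun r => ?_⟩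
    · have hm : (f.map (algebraMap R (DualNumber R))).map (fstHom R R R).toRingHom = f := by
        rw [Polynomial.map_map]
        exact Polynomial.map_id
      have h := Polynomial.eval_map_apply (p := f) (algebraMap R (DualNumber R)) z.fst
      rw [hf] at h
      rw [key, hm, hd]
      exact congrArg (· + (inr (φ z.fst * z.snd) : DualNumber R)) h.symm
    · intro z w h
      have h1 := congrArg fst h
      have h2 := congrArg snd h
      simp at h1 h2
      rw [h1] at h2
      exact TrivSqZeroExt.ext h1 ((hu w.fst).mul_left_cancel h2)
    · intro w
      obtain ⟨b, hb⟩ := (hu w.fst).dvd (a := w.snd)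
      refine ⟨inl w.fst + inr b, ?_⟩
      ext <;> simp [hb]
    · change (inl r + inr (φ r * 0) : DualNumber R) = inl r
      simp

open TrivSqZeroExt in
theorem card_polyStabilizer (R : Type*) [CommRing R] :
    Nat.card (polyStabilizer R) = Nat.card
        {φ : R → R | (∃ f : R[X], (∀ a, f.eval a = a) ∧ ∀ a, f.derivative.eval a = φ a) ∧
          ∀ a, IsUnit (φ a)} := by
  rw [polyStabilizer_eq_image]
  refine Nat.card_image_of_injective (fun φ ψ h => _root_.funext fun a => ?_) _
  have : 0 + φ a * 1 = 0 + ψ a * 1 := congrArg snd (congrFun h ((a, 1) : R × R))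
  simpa only [zero_add, mul_one] using this

theorem Polynomial.natDegree_lt_of_mem_degreeLT {R : Type*} [Semiring R] {k : ℕ} (hk : 0 < k)
    {q : R[X]} (hq : q ∈ degreeLT R k) : q.natDegree < k := by
  by_cases h : q = 0
  · simpa [h] using hk
  · exact (natDegree_lt_iff_degree_lt h).2 (mem_degreeLT.1 hq)

namespace ZMod

variable {p n : ℕ}

theorem isUnit_natCast_sub_natCast_prime_pow (hp : p.Prime) {a b : ℕ} (h : a % p ≠ b % p) :
    IsUnit ((a : ZMod (p ^ n)) - b) := by
  have hab : ¬ (p : ℤ) ∣ (a : ℤ) - b := fun hd => h ((Nat.modEq_iff_dvd.2 hd).symm)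
  have := (coe_int_isUnit_iff_isCoprime ((a : ℤ) - b) (p ^ n)).2 (by
    push_cast
    exact ((Nat.prime_iff_prime_int.1 hp).coprime_iff_not_dvd.2 hab).pow_left)
  simpa using this

theorem isUnit_natCast_prime_pow (hp : p.Prime) {a : ℕ} (h : ¬ p ∣ a) :
    IsUnit (a : ZMod (p ^ n)) := by
  have := isUnit_natCast_sub_natCast_prime_pow (n := n) hp (a := a) (b := 0)
    (by rwa [Nat.zero_mod, Ne, ← Nat.dvd_iff_mod_eq_zero])
  simpa using this

theorem natCast_prime_pow_eq_zero {k : ℕ} (h : n ≤ k) : (p : ZMod (p ^ n)) ^ k = 0 := by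
  rw [← Nat.cast_pow, natCast_eq_zero_iff]
  exact pow_dvd_pow p h

/-- The power `(p - 1) * p ^ n` is the characteristic function of the nonmultiples of `p`. -/
theorem natCast_sub_natCast_pow (hp : p.Prime) (a c : ℕ) :
    ((a : ZMod (p ^ n)) - c) ^ ((p - 1) * p ^ n) = if a % p = c % p then 0 else 1 := by
  split_ifs with h
  · obtain ⟨k, hk⟩ := Nat.modEq_iff_dvd.1 (show c ≡ a [MOD p] from h.symm)
    have h' : (a : ZMod (p ^ n)) - c = p * k := by
      exact_mod_cast congrArg (Int.cast (R := ZMod (p ^ n))) hk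
    have hle : n ≤ (p - 1) * p ^ n :=
      (Nat.lt_pow_self hp.one_lt).le.trans (Nat.le_mul_of_pos_left _ (Nat.sub_pos_of_lt hp.one_lt))
    rw [h', mul_pow, natCast_prime_pow_eq_zero hle, zero_mul]
  · obtain ⟨u, hu⟩ := isUnit_natCast_sub_natCast_prime_pow (n := n) hp h
    have hd : (p ^ n).totient ∣ (p - 1) * p ^ n := by
      rcases n.eq_zero_or_pos with rfl | hn
      · simp
      · rw [Nat.totient_prime_pow hp hn, mul_comm]
        exact mul_dvd_mul_left _ (pow_dvd_pow p (Nat.sub_le _ _))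
    obtain ⟨k, hk⟩ := hd
    rw [← hu, hk, ← Units.val_pow_eq_pow_val, pow_mul, pow_totient, one_pow, Units.val_one]

/-- Polynomials chosen independently on the residue classes modulo `p` glue, together with
their derivatives. -/
theorem exists_eval_eq_on_residues (hp : p.Prime) (G : ℕ → (ZMod (p ^ n))[X]) :
    ∃ F : (ZMod (p ^ n))[X], ∀ a : ℕ,
      F.eval (a : ZMod (p ^ n)) = (G (a % p)).eval (a : ZMod (p ^ n)) ∧
      F.derivative.eval (a : ZMod (p ^ n)) = (G (a % p)).derivative.eval (a : ZMod (p ^ n)) := by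
  let e (c : ℕ) : (ZMod (p ^ n))[X] := 1 - (X - C (c : ZMod (p ^ n))) ^ ((p - 1) * p ^ n)
  have he (a c : ℕ) (hc : c < p) : (e c).eval (a : ZMod (p ^ n)) = if a % p = c then 1 else 0 := by
    have := natCast_sub_natCast_pow (n := n) hp a c
    rw [Nat.mod_eq_of_lt hc] at this
    simp only [e, eval_sub, eval_one, eval_pow, eval_X, eval_C, this]
    split_ifs <;> simp
  have he' (c : ℕ) : (e c).derivative = 0 := by
    have : (((p - 1) * p ^ n : ℕ) : ZMod (p ^ n)) = 0 := by
      rw [natCast_eq_zero_iff]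
      exact dvd_mul_left _ _
    simp only [e, derivative_sub, derivative_one, derivative_X_sub_C_pow, this, map_zero, zero_mul,
      sub_zero]
  have hsum (a : ℕ) (H : ℕ → (ZMod (p ^ n))[X]) :
      (∑ c ∈ Finset.range p, e c * H c).eval (a : ZMod (p ^ n)) =
        (H (a % p)).eval (a : ZMod (p ^ n)) := by
    rw [eval_finsetSum, Finset.sum_eq_single (a % p)]
    · rw [eval_mul, he _ _ (Nat.mod_lt _ hp.pos), if_pos rfl, one_mul]
    · intro c hc hne
      rw [eval_mul, he _ _ (Finset.mem_range.1 hc), if_neg hne.symm, zero_mul]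
    · intro h
      exact absurd (Finset.mem_range.2 (Nat.mod_lt _ hp.pos)) h
  refine ⟨∑ c ∈ Finset.range p, e c * G c, fun a => ⟨hsum a G, ?_⟩⟩
  rw [← hsum a fun c => (G c).derivative, derivative_sum]
  simp [derivative_mul, he']

theorem eq_zero_of_eval_natCast_eq_zero (hp : p.Prime) {f : (ZMod (p ^ n))[X]}
    (hdeg : f.natDegree < p) (h : ∀ s < p, f.eval (s : ZMod (p ^ n)) = 0) : f = 0 := by
  let v : Fin p → ZMod (p ^ n) := fun i => (i : ℕ)
  have hdet : IsUnit (Matrix.vandermonde v).det := by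
    rw [Matrix.det_vandermonde, IsUnit.prod_univ_iff]
    intro i
    rw [IsUnit.prod_iff]
    intro j hj
    refine isUnit_natCast_sub_natCast_prime_pow hp ?_
    rw [Nat.mod_eq_of_lt j.2, Nat.mod_eq_of_lt i.2]
    exact fun h => (Finset.mem_Ioi.1 hj).ne (Fin.ext h.symm)
  have hmul : (Matrix.vandermonde v).mulVec (fun i => f.coeff i) = 0 := by
    ext i
    have := h i i.2
    rw [eval_eq_sum_range' hdeg, Finset.sum_range] at this
    simpa [Matrix.mulVec, dotProduct, Matrix.vandermonde, v, mul_comm] using this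
  have hz : (fun i : Fin p => f.coeff i) = 0 := by
    refine Matrix.mulVec_injective_of_isUnit ((Matrix.isUnit_iff_isUnit_det _).2 hdet) ?_
    simpa using hmul
  ext j
  rcases lt_or_ge j p with hj | hj
  · exact congrFun hz ⟨j, hj⟩
  · exact coeff_eq_zero_of_natDegree_lt (hdeg.trans_le hj)

/-- Multiplication by `p ^ (n - 1)`, as a map from `ZMod p` to `ZMod (p ^ n)`. -/
def mulPrimePow (p n : ℕ) (x : ZMod p) : ZMod (p ^ n) := p ^ (n - 1) * (x.val : ZMod (p ^ n))

theorem mulPrimePow_natCast (hn : 1 ≤ n) (m : ℕ) :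
    mulPrimePow p n (m : ZMod p) = p ^ (n - 1) * (m : ZMod (p ^ n)) := by
  have h : (p : ZMod (p ^ n)) ^ (n - 1) * p = 0 := by
    rw [← pow_succ]
    exact natCast_prime_pow_eq_zero (by omega)
  rw [mulPrimePow, val_natCast]
  conv_rhs => rw [← Nat.mod_add_div m p]
  push_cast
  rw [mul_add, ← mul_assoc, h, zero_mul, add_zero]

theorem mulPrimePow_injective (hp : p.Prime) (hn : 1 ≤ n) :
    Function.Injective (mulPrimePow p n) := by
  have : NeZero p := ⟨hp.ne_zero⟩
  intro x y h
  have h' : ((p ^ (n - 1) * x.val : ℕ) : ZMod (p ^ n)) =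
      ((p ^ (n - 1) * y.val : ℕ) : ZMod (p ^ n)) := by
    simpa [mulPrimePow] using h
  have hlt (z : ZMod p) : p ^ (n - 1) * z.val < p ^ n := by
    conv_rhs => rw [← Nat.sub_add_cancel hn, pow_succ]
    exact Nat.mul_lt_mul_of_pos_left z.val_lt (pow_pos hp.pos _)
  have h2 := congrArg val h'
  rw [val_cast_of_lt (hlt x), val_cast_of_lt (hlt y)] at h2
  exact val_injective p (Nat.eq_of_mul_eq_mul_left (pow_pos hp.pos _) h2)

theorem isUnit_one_add_mulPrimePow (hn : 2 ≤ n) (x : ZMod p) :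
    IsUnit (1 + mulPrimePow p n x) := by
  refine IsNilpotent.isUnit_one_add ⟨2, ?_⟩
  rw [mulPrimePow, mul_pow, ← pow_mul, natCast_prime_pow_eq_zero (by omega), zero_mul]

theorem exists_eq_prime_pow_mul (hp : p.Prime) (hn : 1 ≤ n) {x : ZMod (p ^ n)}
    (hx : x * p = 0) : ∃ v : ℕ, x = p ^ (n - 1) * (v : ZMod (p ^ n)) := by
  have : NeZero (p ^ n) := ⟨pow_ne_zero _ hp.ne_zero⟩
  have h : ((x.val * p : ℕ) : ZMod (p ^ n)) = 0 := by simpa using hx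
  rw [natCast_eq_zero_iff] at h
  conv at h => lhs; rw [← Nat.sub_add_cancel hn, pow_succ]
  obtain ⟨v, hv⟩ := Nat.dvd_of_mul_dvd_mul_right hp.pos h
  refine ⟨v, ?_⟩
  rw [← natCast_zmod_val x, hv]
  push_cast
  rfl

theorem coeff_taylor_mul_pow_eq_zero (hp : p.Prime) (hnp : n ≤ p) {g : (ZMod (p ^ n))[X]}
    (hg : ∀ a, g.eval a = 0) (c : ZMod (p ^ n)) (j : ℕ) :
    (taylor c g).coeff j * (p : ZMod (p ^ n)) ^ j = 0 := by
  have h : (taylor c g).comp (C (p : ZMod (p ^ n)) * X) = 0 := by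
    refine eq_zero_of_eval_natCast_eq_zero hp ?_ fun s _ => by rw [eval_comp, taylor_eval, hg]
    refine (natDegree_le_iff_coeff_eq_zero.2 fun j hj => ?_).trans_lt (Nat.sub_lt hp.pos one_pos)
    rw [comp_C_mul_X_coeff, natCast_prime_pow_eq_zero (by omega), mul_zero]
  rw [← comp_C_mul_X_coeff, h, coeff_zero]

theorem exists_derivative_eval_eq_mulPrimePow (hp : p.Prime) (hn : 1 ≤ n) (hnp : n ≤ p)
    {g : (ZMod (p ^ n))[X]} (hg : ∀ a, g.eval a = 0) (c : ℕ) :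
    ∃ q ∈ degreeLT (ZMod p) (min n (p - 1)), ∀ s : ℕ,
      g.derivative.eval ((c + p * s : ℕ) : ZMod (p ^ n)) =
        mulPrimePow p n (q.eval (s : ZMod p)) := by
  set t := taylor (c : ZMod (p ^ n)) g with ht
  have hcoeff := coeff_taylor_mul_pow_eq_zero hp hnp hg c
  have hex (j : ℕ) : ∃ v : ℕ, t.coeff (j + 1) * (p : ZMod (p ^ n)) ^ j =
      p ^ (n - 1) * (v : ZMod (p ^ n)) :=
    exists_eq_prime_pow_mul hp hn (by rw [mul_assoc, ← pow_succ]; exact hcoeff (j + 1))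
  choose v hv using hex
  refine ⟨∑ i ∈ Finset.range (min n (p - 1)), C (((i + 1) * v i : ℕ) : ZMod p) * X ^ i,
    Submodule.sum_mem _ fun i hi => ?_, fun s => ?_⟩
  · rw [mem_degreeLT]
    exact (degree_C_mul_X_pow_le _ _).trans_lt (by exact_mod_cast Finset.mem_range.1 hi)
  have hval : (∑ i ∈ Finset.range (min n (p - 1)), C (((i + 1) * v i : ℕ) : ZMod p) * X ^ i).eval
      (s : ZMod p) =
        ((∑ i ∈ Finset.range (min n (p - 1)), (i + 1) * v i * s ^ i : ℕ) : ZMod p) := by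
    rw [eval_finsetSum]
    push_cast
    simp
  have hder : g.derivative.eval ((c + p * s : ℕ) : ZMod (p ^ n)) =
      t.derivative.eval (p * s : ZMod (p ^ n)) := by
    rw [ht, taylor_apply, derivative_comp, eval_mul, eval_comp]
    simp [add_comm]
  have hzero (j : ℕ) (hj : min n (p - 1) ≤ j) :
      t.coeff (j + 1) * (j + 1) * (p : ZMod (p ^ n)) ^ j = 0 := by
    rcases le_or_gt n j with h | h
    · rw [natCast_prime_pow_eq_zero h, mul_zero]
    · have hjp : j + 1 = p := by have := hp.pos; omega
      have hc : (j : ZMod (p ^ n)) + 1 = p := by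
        exact_mod_cast congrArg (Nat.cast (R := ZMod (p ^ n))) hjp
      rw [hc, mul_assoc, ← pow_succ']
      exact hcoeff (j + 1)
  rw [hval, mulPrimePow_natCast hn, hder,
    eval_eq_sum_range' (n := max (min n (p - 1)) (t.derivative.natDegree + 1)) (by omega),
    ← Finset.sum_subset (Finset.range_mono (le_max_left (min n (p - 1)) _))]
  · push_cast
    rw [Finset.mul_sum]
    refine Finset.sum_congr rfl fun j _ => ?_
    rw [coeff_derivative, mul_pow]
    linear_combination ((j : ZMod (p ^ n)) + 1) * s ^ j * hv j
  · intro j _ hj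
    rw [coeff_derivative, mul_pow, ← mul_assoc,
      hzero j (not_lt.1 fun h => hj (Finset.mem_range.2 h)), zero_mul]

theorem exists_eval_eq_self_derivative_eval_eq (hp : p.Prime) (hn : 1 ≤ n)
    (q : ℕ → (ZMod p)[X]) (hq : ∀ c, q c ∈ degreeLT (ZMod p) (min n (p - 1))) :
    ∃ f : (ZMod (p ^ n))[X], (∀ a, f.eval a = a) ∧ ∀ a : ℕ,
      f.derivative.eval (a : ZMod (p ^ n)) =
        1 + mulPrimePow p n ((q (a % p)).eval ((a / p : ℕ) : ZMod p)) := by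
  have : Fact p.Prime := ⟨hp⟩
  have : NeZero (p ^ n) := ⟨pow_ne_zero _ hp.ne_zero⟩
  let u (c i : ℕ) : ℕ := ((q c).coeff i / (i + 1 : ℕ)).val
  have hu (c i : ℕ) (hi : i < min n (p - 1)) :
      (((i + 1) * u c i : ℕ) : ZMod p) = (q c).coeff i := by
    have hne : ((i + 1 : ℕ) : ZMod p) ≠ 0 := by
      rw [Ne, natCast_eq_zero_iff]
      exact Nat.not_dvd_of_pos_of_lt i.succ_pos (by omega)
    rw [Nat.cast_mul, natCast_zmod_val, mul_div_cancel₀ _ hne]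
  obtain ⟨f, hf⟩ := exists_eval_eq_on_residues (n := n) hp fun c =>
    X + ∑ i ∈ Finset.range (min n (p - 1)),
      C ((u c i : ZMod (p ^ n)) * p ^ (n - 1 - i)) * (X - C (c : ZMod (p ^ n))) ^ (i + 1)
  have hsub (a : ℕ) : (a : ZMod (p ^ n)) - (a % p : ℕ) = p * (a / p : ℕ) := by
    rw [sub_eq_iff_eq_add, add_comm]
    exact_mod_cast congrArg (Nat.cast (R := ZMod (p ^ n))) (Nat.mod_add_div a p).symm
  refine ⟨f, fun a => ?_, fun a => ?_⟩
  · rw [← natCast_zmod_val a, (hf _).1, eval_add, eval_X, eval_finsetSum, add_eq_left]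
    refine Finset.sum_eq_zero fun i hi => ?_
    have hi' := Finset.mem_range.1 hi
    simp only [eval_mul, eval_C, eval_pow, eval_sub, eval_X]
    rw [hsub, mul_pow, mul_assoc, ← mul_assoc (_ ^ _), ← pow_add,
      natCast_prime_pow_eq_zero (by omega), zero_mul, mul_zero]
  · have hval : (q (a % p)).eval ((a / p : ℕ) : ZMod p) =
        ((∑ i ∈ Finset.range (min n (p - 1)), (i + 1) * u (a % p) i * (a / p) ^ i : ℕ) :
          ZMod p) := by
      have hpos : 0 < min n (p - 1) := by have := hp.two_le; omega
      rw [eval_eq_sum_range' (natDegree_lt_of_mem_degreeLT hpos (hq _))]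
      rw [Nat.cast_sum]
      refine Finset.sum_congr rfl fun i hi => ?_
      rw [Nat.cast_mul, hu _ _ (Finset.mem_range.1 hi), Nat.cast_pow]
    rw [(hf a).2, hval, mulPrimePow_natCast hn, derivative_add, derivative_X, eval_add, eval_one,
      derivative_sum, eval_finsetSum]
    push_cast
    rw [Finset.mul_sum]
    congr 1
    refine Finset.sum_congr rfl fun i hi => ?_
    have hi' := Finset.mem_range.1 hi
    have hpow : (p : ZMod (p ^ n)) ^ (n - 1) = p ^ (n - 1 - i) * p ^ i := by
      rw [← pow_add]
      congr 1
      omega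
    rw [derivative_C_mul, derivative_X_sub_C_pow, hpow]
    simp only [eval_mul, eval_C, eval_pow, eval_sub, eval_X, Nat.add_sub_cancel]
    rw [hsub]
    push_cast
    ring

/-- The functions `f'` on `ZMod (p ^ n)`, for `f` inducing the identity, are parametrised by
polynomials of degree less than `min n (p - 1)` on each residue class modulo `p`. -/
theorem card_unit_derivatives_of_two_le (hp : p.Prime) (hn : 2 ≤ n) (hnp : n ≤ p) :
    Nat.card {φ : ZMod (p ^ n) → ZMod (p ^ n) |
      (∃ f : (ZMod (p ^ n))[X], (∀ a, f.eval a = a) ∧ ∀ a, f.derivative.eval a = φ a) ∧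
        ∀ a, IsUnit (φ a)} = p ^ (min n (p - 1) * p) := by
  have : Fact p.Prime := ⟨hp⟩
  have : NeZero (p ^ n) := ⟨pow_ne_zero _ hp.ne_zero⟩
  let W (q : ZMod p → degreeLT (ZMod p) (min n (p - 1))) (a : ZMod (p ^ n)) : ZMod (p ^ n) :=
    1 + mulPrimePow p n ((q (a.val : ZMod p)).1.eval ((a.val / p : ℕ) : ZMod p))
  have hW : Function.Injective W := by
    intro q r h
    funext c
    have hpos : 0 < min n (p - 1) := by have := hp.two_le; omega
    have hd (q : degreeLT (ZMod p) (min n (p - 1))) : q.1.natDegree < p :=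
      (natDegree_lt_of_mem_degreeLT hpos q.2).trans_le (by omega)
    refine Subtype.ext (eq_of_natDegree_lt_card_of_eval_eq _ _ Function.injective_id (fun s => ?_)
      (by rw [ZMod.card]; exact max_lt (hd _) (hd _)))
    have hlt : c.val + p * s.val < p ^ n := by
      have h1 : c.val + p * s.val < p ^ 2 := by nlinarith [c.val_lt, s.val_lt]
      exact h1.trans_le (Nat.pow_le_pow_right hp.pos hn)
    have hdiv : (c.val + p * s.val) / p = s.val := by
      rw [Nat.add_mul_div_left _ _ hp.pos, Nat.div_eq_of_lt c.val_lt, zero_add]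
    have := congrFun h ((c.val + p * s.val : ℕ) : ZMod (p ^ n))
    simp only [W, val_cast_of_lt hlt, hdiv] at this
    simpa using mulPrimePow_injective hp (by omega) (add_left_cancel this)
  have hrange : {φ : ZMod (p ^ n) → ZMod (p ^ n) |
      (∃ f : (ZMod (p ^ n))[X], (∀ a, f.eval a = a) ∧ ∀ a, f.derivative.eval a = φ a) ∧
        ∀ a, IsUnit (φ a)} = Set.range W := by
    ext φ
    constructor
    · rintro ⟨⟨f, hf, hd⟩, -⟩
      have hg : ∀ a, (f - X).eval a = 0 := fun a => by rw [eval_sub, hf, eval_X, sub_self]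
      choose q hq hqd using fun c : ZMod p =>
        exists_derivative_eval_eq_mulPrimePow hp (by omega) hnp hg c.val
      refine ⟨fun c => ⟨q c, hq c⟩, _root_.funext fun a => ?_⟩
      have h := hqd (a.val : ZMod p) (a.val / p)
      rw [val_natCast, Nat.mod_add_div, natCast_zmod_val, derivative_sub, derivative_X, eval_sub,
        eval_one, hd] at h
      simp only [W]
      rw [← h]
      ring
    · rintro ⟨q, rfl⟩
      obtain ⟨f, hf, hd⟩ := exists_eval_eq_self_derivative_eval_eq hp (by omega : 1 ≤ n)
        (fun c => (q (c : ZMod p)).1) fun c => (q (c : ZMod p)).2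
      refine ⟨⟨f, hf, fun a => ?_⟩, fun a => isUnit_one_add_mulPrimePow hn _⟩
      have h := hd a.val
      rw [natCast_zmod_val] at h
      simp [h, W]
  rw [hrange, Nat.card_range_of_injective hW, Nat.card_fun,
    Nat.card_congr (degreeLTEquiv (ZMod p) (min n (p - 1))).toEquiv, Nat.card_fun]
  simp [pow_mul]

theorem card_unit_derivatives_prime (hp : p.Prime) :
    Nat.card {φ : ZMod (p ^ 1) → ZMod (p ^ 1) |
      (∃ f : (ZMod (p ^ 1))[X], (∀ a, f.eval a = a) ∧ ∀ a, f.derivative.eval a = φ a) ∧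
        ∀ a, IsUnit (φ a)} = (p - 1) ^ p := by
  have : NeZero (p ^ 1) := ⟨pow_ne_zero _ hp.ne_zero⟩
  have hset : {φ : ZMod (p ^ 1) → ZMod (p ^ 1) |
      (∃ f : (ZMod (p ^ 1))[X], (∀ a, f.eval a = a) ∧ ∀ a, f.derivative.eval a = φ a) ∧
        ∀ a, IsUnit (φ a)} =
      Set.range fun (u : ZMod (p ^ 1) → (ZMod (p ^ 1))ˣ) a => (u a : ZMod (p ^ 1)) := by
    ext φ
    constructor
    · rintro ⟨-, h⟩
      choose u hu using h
      exact ⟨u, _root_.funext hu⟩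
    · rintro ⟨u, rfl⟩
      obtain ⟨f, hf⟩ := exists_eval_eq_on_residues (n := 1) hp fun c =>
        C (c : ZMod (p ^ 1)) + C (u c : ZMod (p ^ 1)) * (X - C (c : ZMod (p ^ 1)))
      have hmod (a : ZMod (p ^ 1)) : a.val % p = a.val :=
        Nat.mod_eq_of_lt (a.val_lt.trans_eq (pow_one p))
      refine ⟨⟨f, fun a => ?_, fun a => ?_⟩, fun a => (u a).isUnit⟩
      · have h := (hf a.val).1
        simpa only [hmod, natCast_zmod_val, eval_add, eval_mul, eval_sub, eval_C, eval_X, sub_self,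
          mul_zero, add_zero] using h
      · have h := (hf a.val).2
        simpa only [hmod, natCast_zmod_val, derivative_add, derivative_C, zero_add,
          derivative_C_mul, derivative_X_sub_C, mul_one, eval_C] using h
  rw [hset, Nat.card_range_of_injective fun u v h =>
    _root_.funext fun a => Units.ext (congrFun h a), Nat.card_fun]
  simp [Nat.card_eq_fintype_card, card_units_eq_totient, Nat.totient_prime hp]

end ZMod

/-- **Theorem (order of the stabilizer of ℤ_{p^n}).**
For a prime `p` and `1 ≤ n ≤ p`, the order of `St_α(ℤ_{p^n})` is `(p-1)^p`
if `n = 1`, `p^{np}` if `1 < n < p`, and `p^{(n-1)p}` if `n = p`. -/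
theorem card_polyStabilizer_zmod_pn (p n : ℕ) (hp : p.Prime) (hn : 1 ≤ n)
    (hnp : n ≤ p) :
    (n = 1 → Nat.card (polyStabilizer (ZMod (p ^ n))) = (p - 1) ^ p) ∧
      (1 < n → n < p → Nat.card (polyStabilizer (ZMod (p ^ n))) = p ^ (n * p)) ∧
        (n = p → Nat.card (polyStabilizer (ZMod (p ^ n))) = p ^ ((n - 1) * p)) := by
  rw [card_polyStabilizer]
  refine ⟨?_, fun h1 h2 => ?_, ?_⟩
  · rintro rfl
    exact ZMod.card_unit_derivatives_prime hp
  · rw [ZMod.card_unit_derivatives_of_two_le hp h1 hnp, min_eq_left (by omega)]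
  · rintro rfl
    rw [ZMod.card_unit_derivatives_of_two_le hp hp.two_le hnp, min_eq_right (Nat.sub_le _ _)]
end

section
/- Let p be a prime and n a positive integer with 1 ≤ n ≤ p. Then the number of polynomial permutations of the ring of dual numbers ℤ_{p^n}[α] is p! · (p−1)^p · p^{(n²+2n−2)p} if n < p, and p! · (p−1)^p · p^{(n²+2n−3)p} if n = p. -/
open Polynomial

/-- The number of preimages of a subset of the range of a homomorphism of finite groups. -/
lemma AddMonoidHom.card_preimage_of_subset_range {G H : Type*} [AddGroup G] [AddGroup H]
    [Finite G] (φ : G →+ H) (S : Set H) (hS : S ⊆ Set.range φ) :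
    Nat.card (φ ⁻¹' S) = Nat.card S * Nat.card φ.ker := by
  classical
  choose g hg using fun s : S => hS s.2
  have e : φ ⁻¹' S ≃ S × φ.ker :=
    { toFun := fun x => (⟨φ x, x.2⟩, ⟨-g ⟨φ x, x.2⟩ + x, by simp [AddMonoidHom.mem_ker, hg]⟩)
      invFun := fun y => ⟨g y.1 + y.2, by
        have := y.2.2
        rw [AddMonoidHom.mem_ker] at this
        simp [hg, this]⟩
      left_inv := fun x => by simp
      right_inv := fun y => by
        obtain ⟨s, k, hk⟩ := y
        rw [AddMonoidHom.mem_ker] at hk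
        ext <;> simp [hg, hk] }
  rw [Nat.card_congr e, Nat.card_prod]

section LocalEval

variable {A k : Type*} [CommRing A] [Field k]

/-- The function which, on the fibre of `r` over `c`, is the polynomial with coefficients `v c`
in powers of `z - s c`. -/
def localEval (r : A →+* k) (s : k → A) (d : ℕ) : (k → Fin d → A) →+ (A → A) where
  toFun v z := ∑ i, v (r z) i * (z - s (r z)) ^ (i : ℕ)
  map_zero' := by ext; simp
  map_add' u v := by ext z; simp [add_mul, Finset.sum_add_distrib]

variable {r : A →+* k} {s : k → A} {d : ℕ}

lemma localEval_apply (v : k → Fin d → A) (z : A) :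
    localEval r s d v z = ∑ i, v (r z) i * (z - s (r z)) ^ (i : ℕ) := rfl

lemma localEval_apply_add (hs : ∀ c, r (s c) = c) (v : k → Fin d → A) (c : k) {w : A}
    (hw : r w = 0) : localEval r s d v (s c + w) = ∑ i, v c i * w ^ (i : ℕ) := by
  simp [localEval_apply, hs, hw]

lemma map_sub_section (hs : ∀ c, r (s c) = c) (z : A) : r (z - s (r z)) = 0 := by
  simp [hs]

lemma localEval_mem_range_of_eval (hs : ∀ c, r (s c) = c) (hd : ∀ w, r w = 0 → w ^ d = 0)
    (f : A[X]) : (fun z => f.eval z) ∈ Set.range (localEval r s d) := by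
  refine ⟨fun c i => (taylor (s c) f).coeff i, ?_⟩
  ext z
  rw [localEval_apply, Finset.sum_fin_eq_sum_range]
  have h1 : f.eval z = (taylor (s (r z)) f).eval (z - s (r z)) := by
    simp [taylor_eval]
  have hw := hd _ (map_sub_section hs z)
  generalize z - s (r z) = w at *
  rw [h1, eval_eq_sum_range' (n := d + ((taylor (s (r z)) f).natDegree + 1)) (by omega),
    Finset.sum_range_add]
  rw [Finset.sum_eq_zero (s := Finset.range _) (f := fun x => _ * w ^ (d + x))
    (fun i _ => by rw [pow_add, hw]; ring), add_zero]
  exact Finset.sum_congr rfl fun i hi => by simp [Finset.mem_range.1 hi]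

lemma exists_eval_eq_localEval [Finite k] (hs : ∀ c, r (s c) = c)
    (hd : ∀ w, r w = 0 → w ^ d = 0) (hu : ∀ a, r a ≠ 0 → IsUnit a) (v : k → Fin d → A) :
    ∃ f : A[X], ∀ z, localEval r s d v z = f.eval z := by
  obtain ⟨f, hf⟩ := Ideal.exists_forall_sub_mem_ideal
    (I := fun c : k => Ideal.span {(X - C (s c)) ^ d})
    (fun c c' hcc => by
      refine (Ideal.isCoprime_span_singleton_iff _ _).2 ?_
      refine IsCoprime.pow (isCoprime_X_sub_C_of_isUnit_sub (hu _ ?_))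
      simpa [hs, sub_eq_zero] using hcc)
    (fun c => ∑ i, C (v c i) * (X - C (s c)) ^ (i : ℕ))
  refine ⟨f, fun z => ?_⟩
  obtain ⟨g, hg⟩ := Ideal.mem_span_singleton.1 (hf (r z))
  have := congrArg (eval z) hg
  simp only [eval_sub, eval_finsetSum, eval_mul, eval_C, eval_pow, eval_X,
    hd _ (map_sub_section hs z), zero_mul, sub_eq_zero] at this
  rw [localEval_apply, this]

lemma range_localEval [Finite k] (hs : ∀ c, r (s c) = c)
    (hd : ∀ w, r w = 0 → w ^ d = 0) (hu : ∀ a, r a ≠ 0 → IsUnit a) :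
    Set.range (localEval r s d) = {G | ∃ f : A[X], ∀ z, G z = f.eval z} := by
  ext G
  constructor
  · rintro ⟨v, rfl⟩
    exact exists_eval_eq_localEval hs hd hu v
  · rintro ⟨f, hf⟩
    rw [show G = fun z => f.eval z from funext hf]
    exact localEval_mem_range_of_eval hs hd f

lemma map_localEval {m : ℕ} (hs : ∀ c, r (s c) = c) (v : k → Fin (m + 1) → A) (z : A) :
    r (localEval r s (m + 1) v z) = r (v (r z) 0) := by
  rw [localEval_apply, Fin.sum_univ_succ]
  simp [hs]

lemma localEval_bijective_iff {m : ℕ} [Finite A] [Finite k] (hs : ∀ c, r (s c) = c)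
    (hu : ∀ a, r a ≠ 0 → IsUnit a) (hsoc : ∃ e ≠ 0, r e = 0 ∧ ∀ x, r x = 0 → x * e = 0)
    (v : k → Fin (m + 2) → A) :
    Function.Bijective (localEval r s (m + 2) v) ↔
      Function.Bijective (fun c => r (v c 0)) ∧ ∀ c, r (v c 1) ≠ 0 := by
  constructor
  · intro h
    refine ⟨Finite.surjective_iff_bijective.1 fun c => ?_, fun c hc => ?_⟩
    · obtain ⟨z, hz⟩ := h.2 (s c)
      exact ⟨r z, by rw [← map_localEval hs, hz, hs]⟩
    · obtain ⟨e, he0, hre, he⟩ := hsoc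
      have : localEval r s (m + 2) v (s c + e) = localEval r s (m + 2) v (s c + 0) := by
        rw [localEval_apply_add hs v c hre, localEval_apply_add hs v c (map_zero r),
          Fin.sum_univ_succ, Fin.sum_univ_succ, Fin.sum_univ_succ, Fin.sum_univ_succ]
        simp [pow_succ, mul_assoc, he e hre, he _ hc]
      exact he0 (by simpa using h.1 this)
  · rintro ⟨h0, h1⟩
    refine Finite.injective_iff_bijective.1 fun z z' h => ?_
    have hr : r z' = r z := by
      apply h0.1
      simp only [← map_localEval hs, h]
    set P : A[X] := ∑ i, C (v (r z) i) * X ^ (i : ℕ) with hP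
    have hz (y) (hy : r y = r z) :
        localEval r s (m + 2) v y = P.eval (y - s (r z)) := by
      simp [localEval_apply, hy, hP, eval_finsetSum]
    obtain ⟨q, hq⟩ := P.binomExpansion (z - s (r z)) (z' - z)
    rw [hz z rfl, hz z' hr, show z' - s (r z) = (z - s (r z)) + (z' - z) by ring, hq] at h
    have hunit : IsUnit (P.derivative.eval (z - s (r z)) + q * (z' - z)) := by
      apply hu
      have : r (P.derivative.eval (z - s (r z))) = r (v (r z) 1) := by
        rw [hP, Fin.sum_univ_succ, Fin.sum_univ_succ]
        simp [eval_finsetSum, hs]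
      rw [map_add, this, map_mul, map_sub, hr]
      simpa using h1 (r z)
    have : (P.derivative.eval (z - s (r z)) + q * (z' - z)) * (z' - z) = 0 := by
      linear_combination -h
    exact (sub_eq_zero.1 ((hunit.mul_right_eq_zero).1 this)).symm

lemma card_bijective_localEval {m : ℕ} [Finite A] [Finite k] (hs : ∀ c, r (s c) = c)
    (hd : ∀ w, r w = 0 → w ^ (m + 2) = 0)
    (hu : ∀ a, r a ≠ 0 → IsUnit a) (hsoc : ∃ e ≠ 0, r e = 0 ∧ ∀ x, r x = 0 → x * e = 0) :
    Nat.card {G : A → A // (∃ f : A[X], ∀ a, G a = f.eval a) ∧ Function.Bijective G} *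
      Nat.card (localEval r s (m + 2)).ker * Nat.card k ^ (2 * Nat.card k) =
    (Nat.card k).factorial * (Nat.card k - 1) ^ Nat.card k *
      Nat.card A ^ ((m + 2) * Nat.card k) := by
  classical
  have := Fintype.ofFinite k
  let S : Set (A → A) := {G | (∃ f : A[X], ∀ a, G a = f.eval a) ∧ Function.Bijective G}
  let T : Set ((k → k) × (k → k)) := {g | Function.Bijective g} ×ˢ {g | ∀ c, g c ≠ 0}
  let ρ : (k → Fin (m + 2) → A) →+ (k → k) × (k → k) :=
    { toFun := fun v => (fun c => r (v c 0), fun c => r (v c 1))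
      map_zero' := by ext <;> simp
      map_add' := fun u v => by ext <;> simp }
  have hρ : Function.Surjective ρ := fun g =>
    ⟨fun c i => if i = 0 then s (g.1 c) else s (g.2 c), by ext c <;> simp [ρ, hs]⟩
  have hST : localEval r s (m + 2) ⁻¹' S = ρ ⁻¹' T := by
    ext v
    simp only [S, T, Set.mem_preimage, Set.mem_ofPred_eq, localEval_bijective_iff hs hu hsoc]
    exact and_iff_right (exists_eval_eq_localEval hs hd hu v)
  have h1 := (localEval r s (m + 2)).card_preimage_of_subset_range S
    (by rw [range_localEval hs hd hu]; exact fun G hG => hG.1)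
  have h2 := ρ.card_preimage_of_subset_range T (fun g _ => hρ g)
  have h3 := ρ.card_preimage_of_subset_range Set.univ (fun g _ => hρ g)
  have hT : Nat.card T = (Nat.card k).factorial * (Nat.card k - 1) ^ Nat.card k := by
    rw [Nat.card_congr (Equiv.Set.prod _ _), Nat.card_prod]
    congr 1
    · rw [← Nat.card_perm]
      exact Nat.card_congr (Equiv.ofBijective (fun e : Equiv.Perm k => ⟨e, e.bijective⟩)
        ⟨fun a b h => DFunLike.coe_injective (congrArg Subtype.val h),
          fun g => ⟨Equiv.ofBijective g.1 g.2, rfl⟩⟩).symm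
    · rw [Nat.card_congr (α := {g : k → k | ∀ c, g c ≠ 0})
        (Equiv.subtypePiEquivPi (p := fun (_ : k) x => x ≠ 0)), Nat.card_pi]
      simp [Nat.card_eq_fintype_card]
  rw [hST, h2, hT] at h1
  simp only [Set.preimage_univ, Nat.card_univ, Nat.card_prod, Nat.card_fun, Nat.card_eq_fintype_card (α := Fin _), Fintype.card_fin] at h3
  change Nat.card S * _ * _ = _
  rw [← h1, pow_mul (Nat.card A), h3]
  ring

end LocalEval

section DualNumberZMod

variable {p n : ℕ}

lemma ZMod.coeff_eq_zero_of_sum_mul_pow_eq_zero (hp : p.Prime) (hn : n ≠ 0) (hnp : n ≤ p)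
    (c : Fin n → ZMod (p ^ n)) (h : ∀ t : ZMod (p ^ n), ∑ i, c i * t ^ (i : ℕ) = 0) : c = 0 := by
  have hV : IsUnit (Matrix.vandermonde fun j : Fin n => ((j : ℕ) : ZMod (p ^ n))) := by
    rw [Matrix.isUnit_iff_isUnit_det, Matrix.det_vandermonde]
    refine IsUnit.prod_iff.2 fun i _ => IsUnit.prod_iff.2 fun j hj => ?_
    have hij : (i : ℕ) < j := by simpa using hj
    rw [← Nat.cast_sub hij.le, ZMod.isUnit_natCast_iff_not_dvd_pow hp (Nat.pos_of_ne_zero hn)]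
    exact Nat.not_dvd_of_pos_of_lt (by omega) (by omega)
  refine Matrix.mulVec_injective_of_isUnit hV ?_
  ext j
  simpa [Matrix.mulVec, dotProduct, Matrix.vandermonde_apply, mul_comm] using h j

lemma ZMod.card_nsmul_eq_zero (N m : ℕ) [NeZero N] :
    Nat.card {a : ZMod N // m • a = 0} = N.gcd m := by
  simpa [AddMonoidHom.mem_ker] using IsAddCyclic.card_nsmulAddMonoidHom_ker (G := ZMod N) m

/-- The residue map from dual numbers over `ZMod (p ^ n)` to `ZMod p`. -/
def dualNumberResidue (p : ℕ) {n : ℕ} (hn : n ≠ 0) : DualNumber (ZMod (p ^ n)) →+* ZMod p :=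
  (ZMod.castHom (dvd_pow_self p hn) (ZMod p)).comp
    (TrivSqZeroExt.fstHom (ZMod (p ^ n)) (ZMod (p ^ n)) (ZMod (p ^ n))).toRingHom

/-- The section of the residue map given by the least nonnegative representative. -/
def dualNumberLift (p n : ℕ) (c : ZMod p) : DualNumber (ZMod (p ^ n)) :=
  ((c.val : ℕ) : DualNumber (ZMod (p ^ n)))

lemma dualNumberResidue_apply (hn : n ≠ 0) (x : DualNumber (ZMod (p ^ n))) :
    dualNumberResidue p hn x = ZMod.castHom (dvd_pow_self p hn) (ZMod p) x.fst := rfl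

lemma dualNumberResidue_lift [NeZero p] (hn : n ≠ 0) (c : ZMod p) :
    dualNumberResidue p hn (dualNumberLift p n c) = c := by
  simp [dualNumberLift]

lemma dualNumberResidue_eq_zero_iff [NeZero p] (hn : n ≠ 0) (x : DualNumber (ZMod (p ^ n))) :
    dualNumberResidue p hn x = 0 ↔ ∃ t, x.fst = p * t := by
  rw [dualNumberResidue_apply]
  constructor
  · intro h
    rw [← ZMod.natCast_zmod_val x.fst, map_natCast, ZMod.natCast_eq_zero_iff] at h
    obtain ⟨t, ht⟩ := h
    exact ⟨t, by rw [← ZMod.natCast_zmod_val x.fst, ht, Nat.cast_mul]⟩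
  · rintro ⟨t, ht⟩
    rw [ht, map_mul, map_natCast, ZMod.natCast_self, zero_mul]

lemma ZMod.natCast_prime_pow_self (p n : ℕ) : (p : ZMod (p ^ n)) ^ n = 0 := by
  rw [← Nat.cast_pow, ZMod.natCast_self]

lemma pow_eq_zero_of_dualNumberResidue [NeZero p] (hn : n ≠ 0) {w : DualNumber (ZMod (p ^ n))}
    (hw : dualNumberResidue p hn w = 0) : w ^ (n + 1) = 0 := by
  obtain ⟨t, ht⟩ := (dualNumberResidue_eq_zero_iff hn w).1 hw
  ext
  · simp [ht, mul_pow, pow_succ, ZMod.natCast_prime_pow_self]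
  · simp [ht, mul_pow, TrivSqZeroExt.snd_pow, ZMod.natCast_prime_pow_self]

lemma isUnit_of_dualNumberResidue_ne_zero [Fact p.Prime] (hn : n ≠ 0)
    {a : DualNumber (ZMod (p ^ n))} (ha : dualNumberResidue p hn a ≠ 0) : IsUnit a := by
  rw [TrivSqZeroExt.isUnit_iff_isUnit_fst, ← ZMod.natCast_zmod_val a.fst,
    ZMod.isUnit_natCast_iff_not_dvd_pow Fact.out (Nat.pos_of_ne_zero hn),
    ← ZMod.natCast_eq_zero_iff]
  rwa [dualNumberResidue_apply, ← ZMod.natCast_zmod_val a.fst, map_natCast] at ha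

lemma exists_ne_zero_mul_eq_zero_of_dualNumberResidue [Fact p.Prime] (hn : n ≠ 0) :
    ∃ e : DualNumber (ZMod (p ^ n)), e ≠ 0 ∧ dualNumberResidue p hn e = 0 ∧
      ∀ x, dualNumberResidue p hn x = 0 → x * e = 0 := by
  obtain ⟨m, rfl⟩ := Nat.exists_eq_succ_of_ne_zero hn
  have hp : p.Prime := Fact.out
  refine ⟨TrivSqZeroExt.inr ((p : ZMod (p ^ (m + 1))) ^ m), ?_, ?_, fun x hx => ?_⟩
  · intro h
    have := congrArg TrivSqZeroExt.snd h
    rw [TrivSqZeroExt.snd_inr, TrivSqZeroExt.snd_zero, ← Nat.cast_pow,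
      ZMod.natCast_eq_zero_iff, Nat.pow_dvd_pow_iff_le_right hp.one_lt] at this
    omega
  · simp [dualNumberResidue_apply]
  · obtain ⟨t, ht⟩ := (dualNumberResidue_eq_zero_iff hn x).1 hx
    ext
    · simp
    · have := ZMod.natCast_prime_pow_self p (m + 1)
      simp only [TrivSqZeroExt.snd_mul, TrivSqZeroExt.snd_inr, TrivSqZeroExt.fst_inr, ht,
        smul_eq_mul, TrivSqZeroExt.snd_zero, MulOpposite.op_zero, zero_smul, add_zero]
      linear_combination t * this

/-- The factor `i * p ^ (i - 1)` of the derivative of `X ^ i` at the multiples of `p`, replaced by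
`1`, the value of `X ^ i`, for `i = 0`. -/
def slopeFactor (p i : ℕ) : ℕ := if i = 0 then 1 else i * p ^ (i - 1)

lemma sum_mul_pow_eq_zero_iff (hp : p.Prime) (hn : n ≠ 0) (hnp : n ≤ p)
    (u : Fin (n + 1) → DualNumber (ZMod (p ^ n))) :
    (∀ w, dualNumberResidue p hn w = 0 → ∑ i, u i * w ^ (i : ℕ) = 0) ↔
      ∀ i : Fin (n + 1), slopeFactor p i • (u i).fst = 0 ∧ p ^ (i : ℕ) • (u i).snd = 0 := by
  have : NeZero p := ⟨hp.ne_zero⟩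
  have hpn := ZMod.natCast_prime_pow_self p n
  constructor
  · intro h
    have hfst : ∀ t : ZMod (p ^ n), ∑ i : Fin (n + 1), (u i).fst * (p * t) ^ (i : ℕ) = 0 := by
      intro t
      have := congrArg TrivSqZeroExt.fst (h (TrivSqZeroExt.inl (p * t))
        ((dualNumberResidue_eq_zero_iff hn _).2 ⟨t, rfl⟩))
      simpa [TrivSqZeroExt.fst_sum] using this
    have hsnd : ∀ t y : ZMod (p ^ n), ∑ i : Fin (n + 1), ((u i).snd * (p * t) ^ (i : ℕ) +
        (u i).fst * (i * (p * t) ^ ((i : ℕ) - 1) * y)) = 0 := by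
      intro t y
      have := congrArg TrivSqZeroExt.snd (h (TrivSqZeroExt.inl (p * t) + TrivSqZeroExt.inr y)
        ((dualNumberResidue_eq_zero_iff hn _).2 ⟨t, by simp⟩))
      rw [TrivSqZeroExt.snd_sum, TrivSqZeroExt.snd_zero] at this
      rw [← this]
      refine Finset.sum_congr rfl fun i _ => ?_
      simp [TrivSqZeroExt.snd_pow]
      ring
    have hb : ∀ t : ZMod (p ^ n), ∑ i : Fin (n + 1), (u i).snd * (p * t) ^ (i : ℕ) = 0 :=
      fun t => by simpa using hsnd t 0
    have hder : ∀ t : ZMod (p ^ n),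
        ∑ i : Fin (n + 1), (u i).fst * (i * (p * t) ^ ((i : ℕ) - 1)) = 0 := fun t => by
      simpa [Finset.sum_add_distrib, hb t] using hsnd t 1
    have key : ∀ c : Fin (n + 1) → ZMod (p ^ n),
        (∀ t : ZMod (p ^ n), ∑ i : Fin (n + 1), c i * (p * t) ^ (i : ℕ) = 0) →
          ∀ i, c i * (p : ZMod (p ^ n)) ^ (i : ℕ) = 0 := by
      intro c hc i
      have := ZMod.coeff_eq_zero_of_sum_mul_pow_eq_zero hp hn hnp
        (fun i => c i.castSucc * (p : ZMod (p ^ n)) ^ (i : ℕ)) fun t => by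
          have := hc t
          rw [Fin.sum_univ_castSucc] at this
          simpa [mul_pow, hpn, mul_assoc] using this
      refine Fin.lastCases ?_ (fun j => ?_) i
      · simp [hpn]
      · exact congrFun this j
    intro i
    refine ⟨?_, by simpa [mul_comm] using key _ hb i⟩
    refine Fin.cases ?_ (fun j => ?_) i
    · simpa [slopeFactor] using key _ hfst 0
    · have := congrFun (ZMod.coeff_eq_zero_of_sum_mul_pow_eq_zero hp hn hnp
        (fun j => (u j.succ).fst * ((j + 1 : ℕ) * (p : ZMod (p ^ n)) ^ (j : ℕ))) fun t => by
          have := hder t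
          rw [Fin.sum_univ_succ] at this
          simpa [mul_pow, mul_assoc] using this) j
      simpa [slopeFactor, mul_comm] using this
  · intro h w hw
    obtain ⟨t, ht⟩ := (dualNumberResidue_eq_zero_iff hn w).1 hw
    refine Finset.sum_eq_zero fun i _ => ?_
    obtain ⟨h1, h2⟩ := h i
    rw [nsmul_eq_mul] at h1 h2
    push_cast at h2
    rcases Nat.eq_zero_or_eq_succ_pred (i : ℕ) with hi | hi
    · rw [hi] at h1 h2 ⊢
      have h1' : (u i).fst = 0 := by simpa [slopeFactor] using h1
      have h2' : (u i).snd = 0 := by simpa using h2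
      ext <;> simp [h1', h2']
    · generalize (i : ℕ).pred = j at hi
      rw [Nat.succ_eq_add_one] at hi
      rw [hi] at h1 h2 ⊢
      have h3 : ((j + 1 : ℕ) * (p : ZMod (p ^ n)) ^ j) * (u i).fst = 0 := by
        simpa [slopeFactor] using h1
      have h4 : (p : ZMod (p ^ n)) ^ (j + 1) * (u i).fst = 0 := by
        have hj : j + 1 ≤ n := by omega
        rcases (hj.trans hnp).lt_or_eq with hlt | heq
        · have hunit : IsUnit ((j + 1 : ℕ) : ZMod (p ^ n)) :=
            (ZMod.isUnit_natCast_iff_not_dvd_pow hp (Nat.pos_of_ne_zero hn)).2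
              (Nat.not_dvd_of_pos_of_lt (by omega) hlt)
          rw [mul_assoc] at h3
          rw [pow_succ', mul_assoc, hunit.mul_right_eq_zero.1 h3, mul_zero]
        · rw [show j + 1 = n by omega, hpn, zero_mul]
      ext
      · simp only [TrivSqZeroExt.fst_mul, TrivSqZeroExt.fst_pow, TrivSqZeroExt.fst_zero, ht]
        linear_combination t ^ (j + 1) * h4
      · simp only [TrivSqZeroExt.snd_mul, TrivSqZeroExt.fst_pow, TrivSqZeroExt.snd_pow, ht,
          TrivSqZeroExt.snd_zero, Nat.pred_succ, smul_eq_mul, nsmul_eq_mul,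
          MulOpposite.smul_eq_mul_unop, MulOpposite.unop_op]
        linear_combination t ^ j * w.snd * h3 + t ^ (j + 1) * h2

lemma card_ker_localEval [Fact p.Prime] (hn : n ≠ 0) (hnp : n ≤ p) :
    Nat.card (localEval (dualNumberResidue p hn) (dualNumberLift p n) (n + 1)).ker =
      (∏ i ∈ Finset.range (n + 1),
        (p ^ n).gcd (slopeFactor p i) * (p ^ n).gcd (p ^ i)) ^ p := by
  have hp : p.Prime := Fact.out
  let e : (localEval (dualNumberResidue p hn) (dualNumberLift p n) (n + 1)).ker ≃
      (ZMod p → (i : Fin (n + 1)) → {a : ZMod (p ^ n) // slopeFactor p i • a = 0} ×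
        {b : ZMod (p ^ n) // p ^ (i : ℕ) • b = 0}) :=
    { toFun := fun v c i =>
        have h := (sum_mul_pow_eq_zero_iff hp hn hnp (v.1 c)).1 (fun w hw => by
          rw [← localEval_apply_add (dualNumberResidue_lift hn) v.1 c hw,
            AddMonoidHom.mem_ker.1 v.2]; rfl) i
        (⟨(v.1 c i).fst, h.1⟩, ⟨(v.1 c i).snd, h.2⟩)
      invFun := fun g => ⟨fun c i =>
          TrivSqZeroExt.inl (g c i).1.1 + TrivSqZeroExt.inr (g c i).2.1, by
        refine AddMonoidHom.mem_ker.2 (funext fun z => ?_)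
        exact (sum_mul_pow_eq_zero_iff hp hn hnp _).2
          (fun i => by simpa using And.intro (g _ i).1.2 (g _ i).2.2) _
          (map_sub_section (dualNumberResidue_lift hn) z)⟩
      left_inv := fun v => by ext <;> simp
      right_inv := fun g => by ext <;> simp }
  rw [Nat.card_congr e, Nat.card_fun, Nat.card_pi, Nat.card_zmod]
  simp only [Nat.card_prod, ZMod.card_nsmul_eq_zero]
  rw [Finset.prod_range]

lemma prod_gcd_slopeFactor (hp : p.Prime) {m : ℕ} (hmn : m ≤ n) (hmp : m < p) :
    ∏ i ∈ Finset.range (m + 1), (p ^ n).gcd (slopeFactor p i) * (p ^ n).gcd (p ^ i) =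
      p ^ (m ^ 2) := by
  induction m with
  | zero => simp [slopeFactor]
  | succ m ih =>
    have hc : (p ^ n).gcd (m + 1) = 1 :=
      Nat.Coprime.pow_left _ (Nat.coprime_of_lt_prime (by omega) hmp hp)
    have h1 : (p ^ n).gcd ((m + 1) * p ^ m) = p ^ m := by
      rw [Nat.Coprime.gcd_mul_left_cancel_right _ (Nat.Coprime.symm hc),
        Nat.gcd_eq_right (pow_dvd_pow p (by omega))]
    rw [Finset.prod_range_succ, ih (by omega) (by omega),
      Nat.gcd_eq_right (pow_dvd_pow p hmn)]
    simp only [slopeFactor, Nat.succ_ne_zero, if_false, Nat.add_sub_cancel, h1]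
    ring

lemma prod_gcd_slopeFactor_self (hp : p.Prime) :
    ∏ i ∈ Finset.range (p + 1), (p ^ p).gcd (slopeFactor p i) * (p ^ p).gcd (p ^ i) =
      p ^ (p ^ 2 + 1) := by
  obtain ⟨m, hm⟩ := Nat.exists_eq_succ_of_ne_zero hp.ne_zero
  have h1 : slopeFactor p p = p ^ p := by
    rw [slopeFactor, if_neg hp.ne_zero, ← pow_succ', Nat.sub_add_cancel hp.one_le]
  have h2 := prod_gcd_slopeFactor hp (n := p) (m := m) (by omega) (by omega)
  rw [← Nat.succ_eq_add_one m, ← hm] at h2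
  rw [Finset.prod_range_succ, h2, h1, Nat.gcd_self, ← pow_add, ← pow_add]
  congr 1
  rw [hm, Nat.succ_eq_add_one]
  ring

lemma card_polyPerm_dualNumber_mul [Fact p.Prime] (hn : n ≠ 0) (hnp : n ≤ p) :
    Nat.card {G : DualNumber (ZMod (p ^ n)) → DualNumber (ZMod (p ^ n)) //
        (∃ f : Polynomial (DualNumber (ZMod (p ^ n))), ∀ a, G a = f.eval a) ∧
          Function.Bijective G} *
      (∏ i ∈ Finset.range (n + 1),
        (p ^ n).gcd (slopeFactor p i) * (p ^ n).gcd (p ^ i)) ^ p * p ^ (2 * p) =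
      p.factorial * (p - 1) ^ p * p ^ (2 * n * (n + 1) * p) := by
  have hA : Nat.card (DualNumber (ZMod (p ^ n))) = p ^ (2 * n) := by
    rw [show Nat.card (DualNumber (ZMod (p ^ n))) = Nat.card (ZMod (p ^ n) × ZMod (p ^ n)) from rfl,
      Nat.card_prod, Nat.card_zmod]
    ring
  have hfin : Finite (DualNumber (ZMod (p ^ n))) :=
    inferInstanceAs (Finite (ZMod (p ^ n) × ZMod (p ^ n)))
  rw [← card_ker_localEval hn hnp]
  obtain ⟨m, rfl⟩ := Nat.exists_eq_succ_of_ne_zero hn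
  have h := card_bijective_localEval (r := dualNumberResidue p hn)
    (s := dualNumberLift p (m + 1)) (dualNumberResidue_lift hn)
    (fun w hw => pow_eq_zero_of_dualNumberResidue hn hw)
    (fun a ha => isUnit_of_dualNumberResidue_ne_zero hn ha)
    (exists_ne_zero_mul_eq_zero_of_dualNumberResidue hn)
  rw [Nat.card_zmod, hA, ← pow_mul, ← mul_assoc] at h
  exact h

end DualNumberZMod

/-- **Theorem (number of polynomial permutations of ℤ_{p^n}[α]).**
For a prime `p` and `1 ≤ n ≤ p`, the number of polynomial permutations of
`ℤ_{p^n}[α]` equals `p!·(p-1)^p·p^{(n²+2n-2)p}` if `n < p`, and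
`p!·(p-1)^p·p^{(n²+2n-3)p}` if `n = p`. -/
theorem card_polyPerm_dualNumber_zmod_pn (p n : ℕ) (hp : p.Prime) (hn : 1 ≤ n)
    (hnp : n ≤ p) :
    (n < p →
      Nat.card {G : DualNumber (ZMod (p ^ n)) → DualNumber (ZMod (p ^ n)) //
          (∃ f : Polynomial (DualNumber (ZMod (p ^ n))), ∀ a, G a = f.eval a) ∧
            Function.Bijective G} =
        Nat.factorial p * (p - 1) ^ p * p ^ ((n ^ 2 + 2 * n - 2) * p)) ∧
    (n = p →
      Nat.card {G : DualNumber (ZMod (p ^ n)) → DualNumber (ZMod (p ^ n)) //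
          (∃ f : Polynomial (DualNumber (ZMod (p ^ n))), ∀ a, G a = f.eval a) ∧
            Function.Bijective G} =
        Nat.factorial p * (p - 1) ^ p * p ^ ((n ^ 2 + 2 * n - 3) * p)) := by
  have : Fact p.Prime := ⟨hp⟩
  have h := card_polyPerm_dualNumber_mul (n := n) (by omega) hnp
  constructor
  · intro hlt
    rw [prod_gcd_slopeFactor hp le_rfl hlt, ← pow_mul, mul_assoc, ← pow_add] at h
    refine Nat.eq_of_mul_eq_mul_right (pow_pos hp.pos _) (h.trans ?_)
    rw [mul_assoc _ (p ^ _), ← pow_add, ← add_mul, ← add_mul]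
    congr 3
    obtain ⟨m, rfl⟩ := Nat.exists_eq_add_of_le hn
    rw [show (1 + m) ^ 2 + 2 * (1 + m) - 2 = m ^ 2 + 4 * m + 1 by
      rw [Nat.sub_eq_iff_eq_add (by nlinarith)]; ring]
    ring
  · rintro rfl
    rw [prod_gcd_slopeFactor_self hp, ← pow_mul, mul_assoc, ← pow_add] at h
    refine Nat.eq_of_mul_eq_mul_right (pow_pos hp.pos _) (h.trans ?_)
    rw [mul_assoc _ (n ^ _), ← pow_add, ← add_mul, ← add_mul]
    congr 3
    obtain ⟨m, hm⟩ := Nat.exists_eq_add_of_le hn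
    rw [show n ^ 2 + 2 * n - 3 = m ^ 2 + 4 * m by
      rw [hm, Nat.sub_eq_iff_eq_add (by nlinarith)]; ring, hm]
    ring
end

section
/- Let p be a prime and n a positive integer with n ≤ p. Then the number of polynomial functions on the ring of dual numbers ℤ_{p^n}[α] is p^{(n²+2n)p} if n < p, and p^{(n²+2n−1)p} if n = p. -/
open Polynomial

namespace DualNumberPolyFun

/-- The Taylor coefficients of order `< N` at finitely many points can be prescribed arbitrarily
as soon as the differences of these points are units. -/
lemma exists_taylor_coeff_eq {R ι : Type*} [CommRing R] [Finite ι] (v : ι → R)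
    (hv : ∀ i j, i ≠ j → IsUnit (v i - v j)) (N : ℕ) (d : ι → Fin N → R) :
    ∃ f : R[X], ∀ i (j : Fin N), (taylor (v i) f).coeff j = d i j := by
  have hI : Pairwise (Function.onFun IsCoprime
      fun i => Ideal.span {(X - C (v i)) ^ N}) := by
    intro i j hij
    rw [Function.onFun, Ideal.isCoprime_span_singleton_iff]
    exact (isCoprime_X_sub_C_of_isUnit_sub (hv i j hij)).pow
  obtain ⟨f, hf⟩ := Ideal.exists_forall_sub_mem_ideal hI
    fun i => ∑ k : Fin N, C (d i k) * (X - C (v i)) ^ (k : ℕ)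
  refine ⟨f, fun i j => ?_⟩
  obtain ⟨q, hq⟩ := Ideal.mem_span_singleton.mp (hf i)
  rw [sub_eq_iff_eq_add.mp hq]
  have hX : taylor (v i) (X - C (v i)) = X := by
    rw [map_sub, taylor_X, taylor_C, add_sub_cancel_right]
  simp only [map_add, map_sum, taylor_mul, taylor_pow, hX, taylor_C, coeff_add, finsetSum_coeff,
    coeff_X_pow_mul', coeff_C_mul_X_pow, not_le.mpr j.2, if_false, zero_add]
  simp [Fin.val_inj]

/-- The Taylor coefficients of order `< N` at the points `v i`, the one of order `j` being
multiplied by `m j`. -/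
noncomputable def scaledTaylor {R ι : Type*} [CommRing R] (v : ι → R) (N : ℕ) (m : Fin N → R) :
    R[X] →+ (ι → Fin N → R) where
  toFun f i j := m j * (taylor (v i) f).coeff j
  map_zero' := by ext; simp
  map_add' f g := by ext; simp [mul_add]

lemma range_scaledTaylor {R ι : Type*} [CommRing R] [Finite ι] (v : ι → R)
    (hv : ∀ i j, i ≠ j → IsUnit (v i - v j)) (N : ℕ) (m : Fin N → R) :
    Set.range (scaledTaylor v N m) =
      Set.univ.pi fun _ => Set.univ.pi fun j => Set.range (m j * ·) := by
  ext d
  simp only [Set.mem_range, Set.mem_pi, Set.mem_univ, true_implies]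
  constructor
  · rintro ⟨f, rfl⟩ i j
    exact ⟨_, rfl⟩
  · intro h
    choose e he using h
    obtain ⟨f, hf⟩ := exists_taylor_coeff_eq v hv N e
    refine ⟨f, ?_⟩
    ext i j
    rw [← he i j, ← hf i j]
    rfl

lemma card_range_scaledTaylor {R ι : Type*} [CommRing R] [Fintype ι] (v : ι → R)
    (hv : ∀ i j, i ≠ j → IsUnit (v i - v j)) (N : ℕ) (m : Fin N → R) :
    Nat.card (Set.range (scaledTaylor v N m)) =
      (∏ j, Nat.card (Set.range (m j * ·))) ^ Fintype.card ι := by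
  rw [range_scaledTaylor v hv, Nat.card_congr (Equiv.Set.univPi _), Nat.card_pi]
  simp_rw [Nat.card_congr (Equiv.Set.univPi _), Nat.card_pi]
  simp

lemma card_range_natCast_mul (M a : ℕ) (hM : M ≠ 0) :
    Nat.card (Set.range ((a : ZMod M) * ·)) = M / M.gcd a := by
  rw [← ZMod.addOrderOf_coe a hM, ← Nat.card_zmultiples]
  congr 2
  ext x
  simp only [Set.mem_range, SetLike.mem_coe, AddSubgroup.mem_zmultiples_iff]
  constructor
  · rintro ⟨y, rfl⟩
    obtain ⟨k, rfl⟩ := ZMod.intCast_surjective y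
    exact ⟨k, by rw [zsmul_eq_mul, mul_comm]⟩
  · rintro ⟨k, rfl⟩
    exact ⟨k, by rw [zsmul_eq_mul, mul_comm]⟩

/-- A polynomial of degree less than `n` vanishing at `n` points with unit differences is zero. -/
lemma eq_zero_of_forall_sum_mul_pow {R : Type*} [CommRing R] {n : ℕ} (v : Fin n → R)
    (hv : ∀ i j, i ≠ j → IsUnit (v i - v j)) (d : Fin n → R)
    (h : ∀ i, ∑ j, d j * v i ^ (j : ℕ) = 0) : d = 0 := by
  have hdet : IsUnit (Matrix.vandermonde v) := by
    rw [Matrix.isUnit_iff_isUnit_det, Matrix.det_vandermonde, IsUnit.prod_univ_iff]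
    intro i
    rw [IsUnit.prod_iff]
    intro j hj
    exact hv j i (Finset.mem_Ioi.mp hj).ne'
  apply Matrix.mulVec_injective_of_isUnit hdet
  rw [Matrix.mulVec_zero]
  ext i
  simpa [Matrix.mulVec, dotProduct, Matrix.vandermonde, mul_comm] using h i

section ZMod

variable {p n : ℕ}

lemma isUnit_natCast (hp : p.Prime) {a : ℕ} (h0 : 0 < a) (ha : a < p) :
    IsUnit (a : ZMod (p ^ n)) := by
  rw [ZMod.isUnit_iff_coprime]
  exact ((Nat.coprime_of_lt_prime h0.ne' ha hp).pow_left n).symm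

lemma isUnit_natCast_sub (hp : p.Prime) {a b : ℕ} (ha : a < p) (hb : b < p) (hab : a ≠ b) :
    IsUnit ((a : ZMod (p ^ n)) - b) := by
  rcases lt_or_gt_of_ne hab with h | h
  · rw [← IsUnit.neg_iff, neg_sub, ← Nat.cast_sub h.le]
    exact isUnit_natCast hp (by omega) (by omega)
  · rw [← Nat.cast_sub h.le]
    exact isUnit_natCast hp (by omega) (by omega)

lemma eval_add_prime_mul (f : (ZMod (p ^ n))[X]) (c t : ZMod (p ^ n)) :
    f.eval (c + p * t) =
      ∑ j : Fin n, (p : ZMod (p ^ n)) ^ (j : ℕ) * (taylor c f).coeff j * t ^ (j : ℕ) := by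
  have hpn : (p : ZMod (p ^ n)) ^ n = 0 := by
    rw [← Nat.cast_pow, ZMod.natCast_self]
  rw [add_comm, ← taylor_eval, eval_eq_sum_range' (n := n + ((taylor c f).natDegree + 1)) (by omega),
    Finset.sum_range_add, Finset.sum_eq_zero (s := Finset.range (_ + 1)), add_zero,
    Finset.sum_range]
  · exact Finset.sum_congr rfl fun j _ => by ring
  · intro j _
    rw [mul_pow, pow_add (p : ZMod (p ^ n)), hpn]
    ring

/-- A polynomial is null on `ℤ / p ^ n`, `n ≤ p`, iff its scaled Taylor coefficients at
`0, …, p - 1` vanish. -/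
lemma forall_eval_eq_zero_iff (hp : p.Prime) (hnp : n ≤ p) (f : (ZMod (p ^ n))[X]) :
    (∀ x, f.eval x = 0) ↔
      ∀ (c : Fin p) (j : Fin n), (p : ZMod (p ^ n)) ^ (j : ℕ) *
        (taylor ((c : ℕ) : ZMod (p ^ n)) f).coeff j = 0 := by
  constructor
  · intro h c
    refine congrFun (eq_zero_of_forall_sum_mul_pow (fun i : Fin n => ((i : ℕ) : ZMod (p ^ n)))
      (fun i j hij => isUnit_natCast_sub hp (by omega) (by omega) (by omega)) _ fun i => ?_)
    rw [← eval_add_prime_mul, h]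
  · intro h x
    have : NeZero (p ^ n) := ⟨pow_ne_zero _ hp.ne_zero⟩
    have hx : x = ((x.val % p : ℕ) : ZMod (p ^ n)) + p * ((x.val / p : ℕ) : ZMod (p ^ n)) := by
      rw [← Nat.cast_mul, ← Nat.cast_add, Nat.mod_add_div, ZMod.natCast_zmod_val]
    rw [hx, eval_add_prime_mul]
    refine Finset.sum_eq_zero fun j _ => ?_
    rw [h ⟨x.val % p, Nat.mod_lt _ hp.pos⟩ j, zero_mul]

end ZMod

lemma taylor_derivative_coeff {R : Type*} [CommRing R] (r : R) (f : R[X]) (j : ℕ) :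
    (taylor r (derivative f)).coeff j = (taylor r f).coeff (j + 1) * (j + 1) := by
  rw [← coeff_derivative]
  simp [taylor_apply, derivative_comp]

/-- Scaling factors describing when a polynomial and its derivative are both null. -/
def derivScale (p n : ℕ) : Fin (n + 1) → ℕ :=
  Fin.cons 1 fun j => p ^ (j : ℕ) * (j + 1)

lemma null_pair_iff {p n : ℕ} (hp : p.Prime) (hn : 0 < n) (hnp : n ≤ p) (f : (ZMod (p ^ n))[X]) :
    ((∀ x, f.eval x = 0) ∧ ∀ x, (derivative f).eval x = 0) ↔
      scaledTaylor (fun c : Fin p => ((c : ℕ) : ZMod (p ^ n))) (n + 1)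
        (fun j => (derivScale p n j : ZMod (p ^ n))) f = 0 := by
  rw [forall_eval_eq_zero_iff hp hnp, forall_eval_eq_zero_iff hp hnp]
  simp only [funext_iff, scaledTaylor, AddMonoidHom.coe_mk, ZeroHom.coe_mk, Pi.zero_apply,
    Fin.forall_fin_succ, derivScale, Fin.cons_zero, Fin.cons_succ, Fin.val_zero, Fin.val_succ,
    taylor_derivative_coeff]
  push_cast
  constructor
  · rintro ⟨h0, h1⟩ c
    refine ⟨by simpa using h0 c ⟨0, hn⟩, fun j => ?_⟩
    linear_combination h1 c j
  · intro h
    refine ⟨fun c ⟨j, hj⟩ => ?_, fun c j => by linear_combination (h c).2 j⟩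
    cases j with
    | zero => simpa using (h c).1
    | succ k =>
      have hu : IsUnit ((k + 1 : ℕ) : ZMod (p ^ n)) := isUnit_natCast hp k.succ_pos (by omega)
      rw [← hu.mul_right_eq_zero]
      have := (h c).2 ⟨k, by omega⟩
      push_cast
      simp only at this ⊢
      linear_combination (p : ZMod (p ^ n)) * this

/-- The function on dual numbers induced by the polynomial `f + g ε`. -/
noncomputable def evalPair (R : Type*) [CommRing R] : R[X] × R[X] →+ (DualNumber R → DualNumber R) where
  toFun f a := .inl (f.1.eval a.fst) +
    .inr (a.snd * (derivative f.1).eval a.fst + f.2.eval a.fst)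
  map_zero' := by ext <;> simp
  map_add' f g := by
    ext a
    · simp
    · simp
      ring

lemma evalPair_apply_fst {R : Type*} [CommRing R] (f : R[X] × R[X]) (a : DualNumber R) :
    (evalPair R f a).fst = f.1.eval a.fst := by
  simp [evalPair]

lemma evalPair_apply_snd {R : Type*} [CommRing R] (f : R[X] × R[X]) (a : DualNumber R) :
    (evalPair R f a).snd = a.snd * (derivative f.1).eval a.fst + f.2.eval a.fst := by
  simp [evalPair]

lemma eval_monomial_eq_evalPair {R : Type*} [CommRing R] (k : ℕ) (c a : DualNumber R) :
    (monomial k c).eval a = evalPair R (monomial k c.fst, monomial k c.snd) a := by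
  rw [eval_monomial]
  ext
  · simp [evalPair_apply_fst]
  · simp [evalPair_apply_snd, TrivSqZeroExt.snd_pow, derivative_monomial]
    ring

lemma exists_evalPair_eq {R : Type*} [CommRing R] (f : (DualNumber R)[X]) :
    ∃ g, ∀ a, f.eval a = evalPair R g a := by
  induction f using Polynomial.induction_on' with
  | add f₁ f₂ h₁ h₂ =>
    obtain ⟨g₁, h₁⟩ := h₁
    obtain ⟨g₂, h₂⟩ := h₂
    exact ⟨g₁ + g₂, fun a => by rw [eval_add, h₁, h₂, map_add, Pi.add_apply]⟩
  | monomial k c => exact ⟨_, eval_monomial_eq_evalPair k c⟩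

lemma exists_eval_eq_evalPair {R : Type*} [CommRing R] (g : R[X] × R[X]) :
    ∃ f : (DualNumber R)[X], ∀ a, evalPair R g a = f.eval a := by
  have key : ∀ (u : R →+ DualNumber R) (w : R[X] →+ R[X] × R[X]),
      (∀ k c, w (monomial k c) = (monomial k (u c).fst, monomial k (u c).snd)) →
      ∀ h, ∃ f : (DualNumber R)[X], ∀ a, evalPair R (w h) a = f.eval a := by
    intro u w hw h
    induction h using Polynomial.induction_on' with
    | add h₁ h₂ ih₁ ih₂ =>
      obtain ⟨f₁, ih₁⟩ := ih₁
      obtain ⟨f₂, ih₂⟩ := ih₂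
      exact ⟨f₁ + f₂, fun a => by rw [eval_add, map_add, map_add, Pi.add_apply, ih₁, ih₂]⟩
    | monomial k c =>
      exact ⟨monomial k (u c), fun a => by rw [hw, eval_monomial_eq_evalPair]⟩
  obtain ⟨f₁, h₁⟩ := key (TrivSqZeroExt.inlHom R R) (AddMonoidHom.inl _ _) (by simp) g.1
  obtain ⟨f₂, h₂⟩ := key (TrivSqZeroExt.inrHom R R).toAddMonoidHom (AddMonoidHom.inr _ _)
    (by simp) g.2
  refine ⟨f₁ + f₂, fun a => ?_⟩
  rw [eval_add, ← h₁, ← h₂, ← Pi.add_apply, ← map_add]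
  simp

lemma setOf_polyFun_eq_range (R : Type*) [CommRing R] :
    {G : DualNumber R → DualNumber R | ∃ f : (DualNumber R)[X], ∀ a, G a = f.eval a} =
      Set.range (evalPair R) := by
  ext G
  constructor
  · rintro ⟨f, hf⟩
    obtain ⟨g, hg⟩ := exists_evalPair_eq f
    exact ⟨g, funext fun a => by rw [hf, hg]⟩
  · rintro ⟨g, rfl⟩
    exact exists_eval_eq_evalPair g

lemma evalPair_eq_zero_iff {R : Type*} [CommRing R] (f : R[X] × R[X]) :
    evalPair R f = 0 ↔
      ((∀ x, f.1.eval x = 0) ∧ ∀ x, (derivative f.1).eval x = 0) ∧ ∀ x, f.2.eval x = 0 := by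
  constructor
  · intro h
    have h1 : ∀ x, f.1.eval x = 0 := fun x => by
      simpa [evalPair_apply_fst] using congrArg TrivSqZeroExt.fst (congrFun h (.inl x))
    have h2 : ∀ x, f.2.eval x = 0 := fun x => by
      simpa [evalPair_apply_snd] using congrArg TrivSqZeroExt.snd (congrFun h (.inl x))
    refine ⟨⟨h1, fun x => ?_⟩, h2⟩
    simpa [evalPair_apply_snd, h2] using
      congrArg TrivSqZeroExt.snd (congrFun h (.inl x + .inr 1))
  · rintro ⟨⟨h1, h2⟩, h3⟩
    ext a
    · simp [evalPair_apply_fst, h1]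
    · simp [evalPair_apply_snd, h2, h3]

lemma card_range_eq_of_ker_eq {G H K : Type*} [AddGroup G] [AddGroup H] [AddGroup K]
    (φ : G →+ H) (ψ : G →+ K) (h : φ.ker = ψ.ker) :
    Nat.card (Set.range φ) = Nat.card (Set.range ψ) := by
  rw [← AddMonoidHom.coe_range, ← AddMonoidHom.coe_range]
  exact Nat.card_congr ((QuotientAddGroup.quotientKerEquivRange φ).toEquiv.symm.trans
    ((Quotient.congrRight fun a b => by rw [h]).trans
      (QuotientAddGroup.quotientKerEquivRange ψ).toEquiv))

lemma card_polyFun_eq_prod {p n : ℕ} (hp : p.Prime) (hn : 0 < n) (hnp : n ≤ p) :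
    Nat.card {G : DualNumber (ZMod (p ^ n)) → DualNumber (ZMod (p ^ n)) //
        ∃ f : Polynomial (DualNumber (ZMod (p ^ n))), ∀ a, G a = f.eval a} =
      (p ^ n * ∏ j : Fin n, p ^ n / (p ^ n).gcd (p ^ (j : ℕ) * (j + 1)) * p ^ (n - j)) ^ p := by
  have hM : p ^ n ≠ 0 := pow_ne_zero _ hp.ne_zero
  set v : Fin p → ZMod (p ^ n) := fun c => ((c : ℕ) : ZMod (p ^ n)) with hv
  have hv' : ∀ i j, i ≠ j → IsUnit (v i - v j) := fun i j hij =>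
    isUnit_natCast_sub hp i.2 j.2 (Fin.val_ne_of_ne hij)
  let ψ₁ := scaledTaylor v (n + 1) fun j => (derivScale p n j : ZMod (p ^ n))
  let ψ₂ := scaledTaylor v n fun j => ((p ^ (j : ℕ) : ℕ) : ZMod (p ^ n))
  have hker : (evalPair (ZMod (p ^ n))).ker = (ψ₁.prodMap ψ₂).ker := by
    ext f
    rw [AddMonoidHom.mem_ker, AddMonoidHom.mem_ker, evalPair_eq_zero_iff, null_pair_iff hp hn hnp,
      forall_eval_eq_zero_iff hp hnp, AddMonoidHom.coe_prodMap, Prod.map, Prod.mk_eq_zero]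
    refine and_congr_right' ?_
    simp [ψ₂, scaledTaylor, funext_iff, hv]
  have hset := setOf_polyFun_eq_range (ZMod (p ^ n))
  rw [← Set.coe_ofPred, hset, card_range_eq_of_ker_eq _ _ hker, AddMonoidHom.coe_prodMap,
    Set.range_prodMap, Nat.card_congr (Equiv.Set.prod _ _), Nat.card_prod,
    card_range_scaledTaylor v hv', card_range_scaledTaylor v hv', ← mul_pow, Fintype.card_fin]
  simp_rw [card_range_natCast_mul _ _ hM]
  rw [Fin.prod_univ_succ, mul_assoc, ← Finset.prod_mul_distrib]
  simp only [derivScale, Fin.cons_zero, Fin.cons_succ, Nat.gcd_one_right, Nat.div_one]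
  congr 2
  refine Finset.prod_congr rfl fun j _ => ?_
  rw [Nat.gcd_eq_right (pow_dvd_pow p j.2.le), Nat.pow_div j.2.le hp.pos]

lemma div_gcd_pow_mul {p n j : ℕ} (hp : p.Prime) (hj : j < n) (hjp : j + 1 < p) :
    p ^ n / (p ^ n).gcd (p ^ j * (j + 1)) = p ^ (n - j) := by
  have hc : (p ^ n).Coprime (j + 1) :=
    (Nat.coprime_of_lt_prime j.succ_ne_zero hjp hp).pow_left n
  rw [Nat.Coprime.gcd_mul_right_cancel_right _ hc.symm, Nat.gcd_eq_right (pow_dvd_pow p hj.le),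
    Nat.pow_div hj.le hp.pos]

lemma prod_pow_sub_mul_self (p n : ℕ) :
    ∏ j ∈ Finset.range n, p ^ (n - j) * p ^ (n - j) = p ^ (n ^ 2 + n) := by
  simp_rw [← pow_add]
  rw [Finset.prod_pow_eq_pow_sum]
  congr 1
  induction n with
  | zero => simp
  | succ n ih =>
    rw [Finset.sum_range_succ']
    simp only [Nat.add_sub_add_right, ih]
    simp
    ring

end DualNumberPolyFun

open DualNumberPolyFun

/-- **Theorem (number of polynomial functions on ℤ_{p^n}[α]).**
For a prime `p` and a positive integer `n ≤ p`, the number of polynomial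
functions on `ℤ_{p^n}[α]` equals `p^{(n²+2n)p}` if `n < p`, and
`p^{(n²+2n-1)p}` if `n = p`. -/
theorem card_polyFun_dualNumber_zmod_pn (p n : ℕ) (hp : p.Prime) (hn : 0 < n)
    (hnp : n ≤ p) :
    (n < p →
      Nat.card {G : DualNumber (ZMod (p ^ n)) → DualNumber (ZMod (p ^ n)) //
          ∃ f : Polynomial (DualNumber (ZMod (p ^ n))), ∀ a, G a = f.eval a} =
        p ^ ((n ^ 2 + 2 * n) * p)) ∧
    (n = p →
      Nat.card {G : DualNumber (ZMod (p ^ n)) → DualNumber (ZMod (p ^ n)) //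
          ∃ f : Polynomial (DualNumber (ZMod (p ^ n))), ∀ a, G a = f.eval a} =
        p ^ ((n ^ 2 + 2 * n - 1) * p)) := by
  rw [card_polyFun_eq_prod hp hn hnp,
    Fin.prod_univ_eq_prod_range
      (fun j => p ^ n / (p ^ n).gcd (p ^ j * (j + 1)) * p ^ (n - j)) n]
  constructor
  · intro h
    rw [Finset.prod_congr rfl fun j hj => by
      rw [div_gcd_pow_mul hp (Finset.mem_range.mp hj)
        (by have := Finset.mem_range.mp hj; omega)], prod_pow_sub_mul_self, ← pow_add, ← pow_mul]
    congr 2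
    ring
  · rintro rfl
    obtain ⟨k, rfl⟩ : ∃ k, n = k + 1 := ⟨n - 1, by omega⟩
    have hprod := prod_pow_sub_mul_self (k + 1) (k + 1)
    rw [Finset.prod_range_succ] at hprod ⊢
    rw [Finset.prod_congr rfl fun j hj => by
      rw [div_gcd_pow_mul hp (by have := Finset.mem_range.mp hj; omega)
        (by have := Finset.mem_range.mp hj; omega)], ← pow_succ, Nat.gcd_self,
      Nat.div_self (pow_pos hp.pos _), one_mul, pow_mul]
    congr 1
    apply Nat.eq_of_mul_eq_mul_right hp.pos
    have h1 : (k + 1) ^ ((k + 1) ^ 2 + 2 * (k + 1) - 1) * (k + 1) =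
        (k + 1) ^ (k + 1) * (k + 1) ^ ((k + 1) ^ 2 + (k + 1)) := by
      rw [← pow_succ, ← pow_add]
      congr 1
      have : 1 ≤ (k + 1) ^ 2 + 2 * (k + 1) := by omega
      omega
    rw [h1, ← hprod]
    simp only [Nat.add_sub_cancel_left, pow_one]
    ring
end
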